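/- arXiv:1505.08055 — 4 statements merged into one kernel-verified Lean document; each statement's English description precedes it below -/
import Mathlib

section
/- Let d be a nonnegative rational number. The structure R_√d = (ℝ; <, +, ℤ, ℤ√d) defines (without parameters) the function λ_√d : ℝ → ℝ, x ↦ √d · x; that is, the graph {(x, √d·x) : x ∈ ℝ} ⊆ ℝ² is first-order definable without parameters in R_√d. -/
open FirstOrder Real

/-- The language of `R_√d`: a binary function `+`, a binary relation `<`,
and two unary predicates (for `ℤ` and for `ℤ√d`). -/
def rLang : FirstOrder.Language where
  Functions := fun n => match n with
    | 2 => Unit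
    | _ => Empty
  Relations := fun n => match n with
    | 1 => Bool
    | 2 => Unit
    | _ => Empty

/-- The structure `R_√d = (ℝ; <, +, ℤ, ℤ√d)`. -/
def rStruc (d : ℚ) : rLang.Structure ℝ where
  funMap {n} f v :=
    match n, f, v with
    | 2, _, v => v 0 + v 1
  RelMap {n} r v :=
    match n, r, v with
    | 1, false, v => ∃ z : ℤ, v 0 = (z : ℝ)
    | 1, true, v => ∃ z : ℤ, v 0 = (z : ℝ) * Real.sqrt d
    | 2, _, v => v 0 < v 1

/-- `P` is defined by a first-order formula without parameters over `R_√d`. -/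
def Dfn (d : ℚ) {ι : Type} (P : (ι → ℝ) → Prop) : Prop :=
  ∃ φ : rLang.Formula ι, ∀ v, (letI := rStruc d; φ.Realize v) ↔ P v

/-- `f` has a graph defined by a first-order formula without parameters over `R_√d`. -/
def DFun (d : ℚ) {ι : Type} (f : (ι → ℝ) → ℝ) : Prop :=
  Dfn d fun v : Option ι → ℝ => v none = f fun i => v (some i)

namespace Dfn

variable {d : ℚ} {ι κ : Type} {P Q : (ι → ℝ) → Prop}

theorem congr (h : Dfn d P) (e : ∀ v, P v ↔ Q v) : Dfn d Q := by
  obtain ⟨φ, hφ⟩ := h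
  exact ⟨φ, fun v => (hφ v).trans (e v)⟩

theorem not (h : Dfn d P) : Dfn d fun v => ¬ P v := by
  obtain ⟨φ, hφ⟩ := h
  let _ := rStruc d
  exact ⟨φ.not, fun v => by rw [FirstOrder.Language.Formula.realize_not]; exact not_congr (hφ v)⟩

theorem imp (h : Dfn d P) (h' : Dfn d Q) : Dfn d fun v => P v → Q v := by
  obtain ⟨φ, hφ⟩ := h
  obtain ⟨ψ, hψ⟩ := h'
  let _ := rStruc d
  exact ⟨φ.imp ψ, fun v => by
    rw [FirstOrder.Language.Formula.realize_imp]; exact imp_congr (hφ v) (hψ v)⟩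

theorem and (h : Dfn d P) (h' : Dfn d Q) : Dfn d fun v => P v ∧ Q v :=
  (h.imp h'.not).not.congr fun v => by tauto

theorem or (h : Dfn d P) (h' : Dfn d Q) : Dfn d fun v => P v ∨ Q v :=
  (h.not.imp h').congr fun v => by tauto

theorem relabel (h : Dfn d P) (g : ι → κ) : Dfn d fun v : κ → ℝ => P fun i => v (g i) := by
  obtain ⟨φ, hφ⟩ := h
  let _ := rStruc d
  exact ⟨φ.relabel g, fun v => by
    rw [FirstOrder.Language.Formula.realize_relabel]; exact hφ _⟩

theorem ex {Q : (ι → ℝ) → ℝ → Prop}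
    (h : Dfn d fun v : Option ι → ℝ => Q (fun i => v (some i)) (v none)) :
    Dfn d fun v => ∃ x, Q v x := by
  obtain ⟨φ, hφ⟩ := h.relabel (fun o : Option ι => o.elim (Sum.inr ()) Sum.inl : _ → ι ⊕ Unit)
  let _ := rStruc d
  refine ⟨φ.iExs Unit, fun v => ?_⟩
  rw [FirstOrder.Language.Formula.realize_iExs]
  constructor
  · rintro ⟨i, hi⟩
    exact ⟨i (), (hφ _).1 hi⟩
  · rintro ⟨x, hx⟩
    exact ⟨fun _ => x, (hφ _).2 hx⟩

theorem all {Q : (ι → ℝ) → ℝ → Prop}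
    (h : Dfn d fun v : Option ι → ℝ => Q (fun i => v (some i)) (v none)) :
    Dfn d fun v => ∀ x, Q v x :=
  (ex (Q := fun v x => ¬ Q v x) h.not).not.congr fun v => by simp

theorem add_var (i j k : ι) : Dfn d fun v => v k = v i + v j := by
  let _ := rStruc d
  let t : rLang.Term ι :=
    FirstOrder.Language.Term.func (l := 2) (show rLang.Functions 2 from ())
      ![FirstOrder.Language.Term.var i, FirstOrder.Language.Term.var j]
  refine ⟨FirstOrder.Language.Term.equal (FirstOrder.Language.Term.var k) t, fun v => ?_⟩
  rw [FirstOrder.Language.Formula.realize_equal]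
  rfl

theorem eq_var (i j : ι) : Dfn d fun v => v i = v j := by
  let _ := rStruc d
  refine ⟨FirstOrder.Language.Term.equal (FirstOrder.Language.Term.var i)
    (FirstOrder.Language.Term.var j), fun v => ?_⟩
  rw [FirstOrder.Language.Formula.realize_equal]
  rfl

theorem lt_var (i j : ι) : Dfn d fun v => v i < v j := by
  let _ := rStruc d
  refine ⟨FirstOrder.Language.Relations.formula (n := 2) (show rLang.Relations 2 from ())
      ![FirstOrder.Language.Term.var i, FirstOrder.Language.Term.var j], fun v => ?_⟩
  rw [FirstOrder.Language.Formula.realize_rel]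
  rfl

theorem int_var (i : ι) : Dfn d fun v => ∃ z : ℤ, v i = z := by
  let _ := rStruc d
  refine ⟨FirstOrder.Language.Relations.formula (n := 1) (show rLang.Relations 1 from false)
      ![FirstOrder.Language.Term.var i], fun v => ?_⟩
  rw [FirstOrder.Language.Formula.realize_rel]
  rfl

theorem sqrt_var (i : ι) : Dfn d fun v => ∃ z : ℤ, v i = z * √d := by
  let _ := rStruc d
  refine ⟨FirstOrder.Language.Relations.formula (n := 1) (show rLang.Relations 1 from true)
      ![FirstOrder.Language.Term.var i], fun v => ?_⟩
  rw [FirstOrder.Language.Formula.realize_rel]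
  rfl

/-- Substitution of a function with definable graph for the last variable. -/
theorem subst {f : (ι → ℝ) → ℝ} {Q : (ι → ℝ) → ℝ → Prop}
    (h : Dfn d fun v : Option ι → ℝ => Q (fun i => v (some i)) (v none)) (hf : DFun d f) :
    Dfn d fun v => Q v (f v) :=
  (ex (Q := fun v x => x = f v ∧ Q v x) (hf.and h)).congr fun v => by simp

end Dfn

namespace DFun

variable {d : ℚ} {ι : Type} {f g h : (ι → ℝ) → ℝ}

theorem var (i : ι) : DFun d fun v => v i := Dfn.eq_var _ _

theorem weaken (hf : DFun d f) : DFun d fun v : Option ι → ℝ => f fun i => v (some i) :=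
  Dfn.relabel hf fun o : Option ι => o.elim none fun i => some (some i)

theorem add (hf : DFun d f) (hg : DFun d g) : DFun d fun v => f v + g v :=
  Dfn.subst (Q := fun v x => v none = x + g fun i => v (some i))
    (Dfn.subst (Q := fun v x => v (some none) = v none + x)
      (Dfn.add_var _ _ _) hg.weaken.weaken) hf.weaken

theorem eq (hf : DFun d f) (hg : DFun d g) : Dfn d fun v => f v = g v :=
  Dfn.subst (Q := fun v x => x = g v) hg hf

theorem lt (hf : DFun d f) (hg : DFun d g) : Dfn d fun v => f v < g v :=
  Dfn.subst (Q := fun v x => x < g v)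
    (Dfn.subst (Q := fun v x => v none < x) (Dfn.lt_var _ _) hg.weaken) hf

theorem le (hf : DFun d f) (hg : DFun d g) : Dfn d fun v => f v ≤ g v :=
  (hg.lt hf).not.congr fun _ => not_lt

theorem isInt (hf : DFun d f) : Dfn d fun v => ∃ z : ℤ, f v = z :=
  Dfn.subst (Q := fun _ x => ∃ z : ℤ, x = z) (Dfn.int_var _) hf

theorem isSqrt (hf : DFun d f) : Dfn d fun v => ∃ z : ℤ, f v = z * √d :=
  Dfn.subst (Q := fun _ x => ∃ z : ℤ, x = z * √d) (Dfn.sqrt_var _) hf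

theorem sub (hf : DFun d f) (hg : DFun d g) : DFun d fun v => f v - g v :=
  Dfn.congr (((var none).add hg.weaken).eq hf.weaken) fun v => by
    constructor <;> intro h <;> linarith

theorem zero : DFun d fun _ : ι → ℝ => (0 : ℝ) :=
  Dfn.congr (((var none).add (var none)).eq (var none)) fun v => by
    constructor <;> intro h <;> linarith

theorem neg (hf : DFun d f) : DFun d fun v => - f v := by
  simpa using zero.sub hf

theorem natMul (n : ℕ) (hf : DFun d f) : DFun d fun v => (n : ℝ) * f v := by
  induction n with
  | zero => simpa using zero
  | succ n ih => simpa [add_mul] using ih.add hf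

theorem intMul (n : ℤ) (hf : DFun d f) : DFun d fun v => (n : ℝ) * f v := by
  obtain ⟨n, rfl | rfl⟩ := n.eq_nat_or_neg
  · simpa using hf.natMul n
  · simpa using (hf.natMul n).neg

theorem ratMul (r : ℚ) (hf : DFun d f) : DFun d fun v => (r : ℝ) * f v := by
  refine Dfn.congr (((var none).natMul r.den).eq (hf.weaken.intMul r.num)) fun v => ?_
  have hr : (r.den : ℝ) ≠ 0 := by exact_mod_cast r.den_ne_zero
  beta_reduce
  rw [Rat.cast_def, div_mul_eq_mul_div, eq_div_iff hr, mul_comm]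

end DFun

theorem Dfn.exFinset {d : ℚ} {ι σ : Type} (s : Finset σ) {P : σ → (ι → ℝ) → Prop}
    (h : ∀ i, Dfn d (P i)) : Dfn d fun v => ∃ i ∈ s, P i v := by
  classical
  induction s using Finset.induction_on with
  | empty => exact (DFun.zero.lt DFun.zero).congr fun v => by simp
  | insert a s _ ih => exact ((h a).or ih).congr fun v => by simp

/-- A solution `(a, b)` of the Pell equation `a ^ 2 - D * b ^ 2 = 1`,
with an irrational square root `β` of `D`. -/
structure PellBase (D a b : ℤ) (β : ℝ) : Prop where
  pos : 0 < β
  sq : β * β = D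
  irr : Irrational β
  a_pos : 0 < a
  b_pos : 0 < b
  pell : a * a - D * (b * b) = 1

/-- The set of truncations `A` of `n`: those for which `(n - A) * β` is at distance less than `g`
below an integer. -/
def trunc (β g : ℝ) (n : ℤ) : Set ℤ :=
  {A | 0 ≤ A ∧ ∃ j : ℤ, (n - A) * β ≤ j ∧ j < (n - A) * β + g}

/-- `x` is an integer multiple of `β`. -/
def IsMul (β x : ℝ) : Prop := ∃ z : ℤ, x = z * β

/-- `x` is an integer. -/
def IsInt (x : ℝ) : Prop := ∃ z : ℤ, x = z

/-- `p + y` is a totally positive element of the lattice `ℤ + ℤβ` with `0 ≤ y`, and no totally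
positive lattice element is smaller and has a smaller conjugate. -/
def MinimalPoint (β p y : ℝ) : Prop :=
  IsInt p ∧ IsMul β y ∧ 0 ≤ y ∧ y < p ∧
    ∀ s z, IsInt s → IsMul β z → -z < s → z < s → s + z ≤ p + y → p - y ≤ s - z

/-- `A` is the least nonnegative element of `S` such that some element of `T` lies in
`[c * (n - A), c * (n - A) + g)`. -/
def LeastTrunc (S T : ℝ → Prop) (c : ℤ) (g n A : ℝ) : Prop :=
  S A ∧ 0 ≤ A ∧ (∃ j, T j ∧ c * (n - A) ≤ j ∧ j < c * (n - A) + g) ∧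
    ∀ A', S A' → 0 ≤ A' → (∃ j, T j ∧ c * (n - A') ≤ j ∧ j < c * (n - A') + g) → A ≤ A'

/-- A relation that forces `P = β * p` and `R = β * q` for integers `p` and `q`. -/
def Quad (D a b : ℤ) (β : ℝ) (r₁ r₂ : ℚ) (p q P R : ℝ) : Prop :=
  MinimalPoint β p R ∧ MinimalPoint β (a * p + D * (b * q)) (a * R + b * P) ∧
    r₁ * (p + R) < a * p + D * (b * q) + (a * R + b * P) ∧
    a * p + D * (b * q) + (a * R + b * P) < r₂ * (p + R)

/-- A relation that forces `y = β * n` for a nonnegative integer `n`. -/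
def MulGraph (D a b : ℤ) (β : ℝ) (r₁ r₂ : ℚ) (K : ℤ) (n y : ℝ) : Prop :=
  IsInt n ∧ 0 ≤ n ∧ IsMul β y ∧ 0 ≤ y ∧ ∀ p q P R, Quad D a b β r₁ r₂ p q P R →
    ∃ A₀ A₁ z₀ z₁, LeastTrunc IsInt (IsMul β) D (P - D * q) n A₀ ∧
      LeastTrunc IsInt (IsMul β) D (a * P + D * (b * R) - D * (b * p + a * q)) n A₁ ∧
      LeastTrunc (IsMul β) IsInt 1 (p - R) y z₀ ∧
      LeastTrunc (IsMul β) IsInt 1 (a * p + D * (b * q) - (a * R + b * P)) y z₁ ∧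
      ∃ N ∈ Finset.Icc 1 K, ∃ X ∈ Finset.Icc (-K) K, ∃ Y ∈ Finset.Icc (-K) K,
        N * (A₁ - A₀) = Y * p - X * q ∧ N * (z₁ - z₀) = Y * P - X * R

theorem exists_isLeast_trunc {β g : ℝ} (hg : 0 < g) {n : ℤ} (hn : 0 ≤ n) :
    ∃ A, IsLeast (trunc β g n) A := by
  classical
  have hne : ∃ m : ℕ, (m : ℤ) ∈ trunc β g n := by
    refine ⟨n.toNat, by positivity, 0, ?_⟩
    simp [Int.toNat_of_nonneg hn, hg]
  refine ⟨Nat.find hne, Nat.find_spec hne, fun A hA => ?_⟩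
  have : Nat.find hne ≤ A.toNat := Nat.find_min' hne (by rwa [Int.toNat_of_nonneg hA.1])
  have := hA.1
  omega

theorem isLeast_trunc_one {β : ℝ} {n A : ℤ} (hA : IsLeast (trunc β 1 n) A) : A = 0 :=
  le_antisymm (hA.2 ⟨le_rfl, ⌈((n : ℝ) - (0 : ℤ)) * β⌉, Int.le_ceil _, Int.ceil_lt_add_one _⟩)
    hA.1.1

namespace PellBase

variable {D a b : ℤ} {β : ℝ} (h : PellBase D a b β)
include h

theorem norm_eq (X Y : ℤ) : ((X : ℝ) + Y * β) * (X - Y * β) = ((X * X - D * (Y * Y) : ℤ) : ℝ) := by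
  push_cast
  linear_combination -(Y : ℝ) * Y * h.sq

theorem eq_zero_of_mul (X Y : ℤ) (h1 : (X : ℝ) + Y * β = 0) : X = 0 ∧ Y = 0 := by
  have hY : Y = 0 := by
    by_contra hY
    refine h.irr ⟨-X / Y, ?_⟩
    have : (Y : ℝ) ≠ 0 := by exact_mod_cast hY
    push_cast
    field_simp
    linarith
  subst hY
  exact ⟨by simpa using h1, rfl⟩

theorem eq_zero_of_norm_lt (X Y : ℤ) (h1 : |((X : ℝ) + Y * β) * (X - Y * β)| < 1) :
    X = 0 ∧ Y = 0 := by
  have h2 := h1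
  rw [h.norm_eq] at h2
  have h3 : X * X - D * (Y * Y) = 0 := Int.abs_lt_one_iff.1 (by exact_mod_cast h2)
  have h4 := h.norm_eq X Y
  rw [h3, Int.cast_zero, mul_eq_zero] at h4
  rcases h4 with h4 | h4
  · exact h.eq_zero_of_mul X Y h4
  · have := h.eq_zero_of_mul X (-Y) (by push_cast; linarith)
    omega

theorem one_le_norm (X Y : ℤ) (h1 : 0 < (X : ℝ) + Y * β) (h2 : 0 < (X : ℝ) - Y * β) :
    1 ≤ ((X : ℝ) + Y * β) * (X - Y * β) := by
  have h3 := mul_pos h1 h2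
  rw [h.norm_eq] at h3 ⊢
  exact_mod_cast h3

theorem unit_mul_conj : ((a : ℝ) + b * β) * (a - b * β) = 1 := by
  rw [h.norm_eq, h.pell, Int.cast_one]

theorem one_lt_unit : 1 < (a : ℝ) + b * β := by
  have h1 : (1 : ℝ) ≤ a := by exact_mod_cast h.a_pos
  have h2 : (0 : ℝ) < b := by exact_mod_cast h.b_pos
  have := mul_pos h2 h.pos
  linarith

theorem conj_pos : 0 < (a : ℝ) - b * β := by
  have := h.unit_mul_conj
  have h1 := h.one_lt_unit
  by_contra hc
  push Not at hc
  nlinarith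

theorem conj_lt_one : (a : ℝ) - b * β < 1 := by
  have := h.unit_mul_conj
  have h1 := h.one_lt_unit
  have h2 := h.conj_pos
  nlinarith

theorem mul_unit (s t : ℝ) : (s + t * β) * (a + b * β) =
    a * s + D * (b * t) + (a * t + b * s) * β := by
  linear_combination (b : ℝ) * t * h.sq

theorem mul_conj (s t : ℝ) : (s - t * β) * (a - b * β) =
    a * s + D * (b * t) - (a * t + b * s) * β := by
  linear_combination (b : ℝ) * t * h.sq

theorem exists_pow (k : ℕ) : ∃ s t : ℤ, 0 ≤ t ∧ ((a : ℝ) + b * β) ^ k = s + t * β ∧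
    ((a : ℝ) - b * β) ^ k = s - t * β := by
  suffices H : ∃ s t : ℤ, 0 ≤ t ∧ 0 ≤ s ∧ ((a : ℝ) + b * β) ^ k = s + t * β ∧
      ((a : ℝ) - b * β) ^ k = s - t * β by
    obtain ⟨s, t, h1, -, h2⟩ := H
    exact ⟨s, t, h1, h2⟩
  have hD : 0 ≤ D := by
    have := mul_self_nonneg β
    rw [h.sq] at this
    exact_mod_cast this
  have ha := h.a_pos
  have hb := h.b_pos
  induction k with
  | zero => exact ⟨1, 0, le_rfl, zero_le_one, by simp, by simp⟩
  | succ k ih =>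
    obtain ⟨s, t, h1, h2, h3, h4⟩ := ih
    refine ⟨a * s + D * (b * t), a * t + b * s, by positivity, by positivity, ?_, ?_⟩
    · rw [pow_succ, h3, h.mul_unit]
      push_cast
      ring
    · rw [pow_succ, h4, h.mul_conj]
      push_cast
      ring

theorem minimalPoint_of_norm_one (s t : ℤ) (ht : 0 ≤ t) (hpos : 0 < (s : ℝ) - t * β)
    (h1 : ((s : ℝ) + t * β) * (s - t * β) = 1) : MinimalPoint β s (t * β) := by
  refine ⟨⟨s, rfl⟩, ⟨t, rfl⟩, ?_, by linarith, ?_⟩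
  · have := h.pos
    have : (0 : ℝ) ≤ t := by exact_mod_cast ht
    positivity
  · rintro _ _ ⟨x, rfl⟩ ⟨y, rfl⟩ h2 h3 h4
    have h5 := h.one_le_norm x y (by linarith) (by linarith)
    by_contra hc
    push Not at hc
    have h6 : ((x : ℝ) + y * β) * (x - y * β) < (s + t * β) * (s - t * β) :=
      mul_lt_mul' h4 hc (by linarith) (by linarith)
    linarith

theorem norm_le_of_minimalPoint {p y : ℝ} (hm : MinimalPoint β p y) :
    (p + y) * (p - y) ≤ a + b * β := by
  obtain ⟨⟨p, rfl⟩, -, hy, hyp, hmin⟩ := hm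
  have hp : (1 : ℝ) ≤ p := by
    have : (0 : ℝ) < p := by linarith
    exact_mod_cast this
  obtain ⟨k, hk1, hk2⟩ := exists_nat_pow_near (show 1 ≤ (p : ℝ) + y by linarith) h.one_lt_unit
  obtain ⟨s, t, -, h2, h3⟩ := h.exists_pow k
  have he := h.one_lt_unit
  have hpos : 0 < (s : ℝ) - t * β := h3 ▸ pow_pos h.conj_pos k
  have hpos' : 0 < (s : ℝ) + t * β := h2 ▸ pow_pos (by linarith) k
  have h4 := hmin s (t * β) ⟨s, rfl⟩ ⟨t, rfl⟩ (by linarith) (by linarith) (h2 ▸ hk1)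
  have h5 : ((s : ℝ) + t * β) * (s - t * β) = 1 := by
    rw [← h2, ← h3, ← mul_pow, h.unit_mul_conj, one_pow]
  calc ((p : ℝ) + y) * (p - y)
      ≤ ((a + b * β) ^ (k + 1)) * (s - t * β) :=
        mul_le_mul hk2.le h4 (by linarith) (by positivity)
    _ = a + b * β := by
        rw [pow_succ, h2]
        linear_combination ((a : ℝ) + b * β) * h5

theorem quad_eq {r₁ r₂ : ℚ} (hr : 1 ≤ r₁) (hr₁ : (r₁ : ℝ) < a + b * β)
    (hr₂ : (a + b * β : ℝ) < r₂) (hr' : ((r₂ : ℝ) - r₁) * (a + b * β) ≤ 1) {p q P R : ℝ}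
    (hq : Quad D a b β r₁ r₂ p q P R) :
    ∃ p' q' : ℤ, p = p' ∧ q = q' ∧ P = p' * β ∧ R = q' * β := by
  obtain ⟨hm, hm₁, hl, hu⟩ := hq
  have hN := h.norm_le_of_minimalPoint hm
  have hN₁ := h.norm_le_of_minimalPoint hm₁
  obtain ⟨⟨p', rfl⟩, ⟨k, rfl⟩, hy, hyp, -⟩ := hm
  obtain ⟨⟨p₁, hp₁⟩, ⟨k₁, hk₁⟩, hy₁, hyp₁, -⟩ := hm₁
  rw [hp₁, hk₁] at hl hu hyp₁ hN₁
  rw [hk₁] at hy₁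
  have he := h.one_lt_unit
  have hc := h.conj_pos
  have hec := h.unit_mul_conj
  set e := (a : ℝ) + b * β with he'
  have hr1 : (1 : ℝ) ≤ r₁ := by exact_mod_cast hr
  obtain ⟨hX, hY⟩ := h.eq_zero_of_norm_lt (p₁ - (a * p' + D * (b * k))) (k₁ - (a * k + b * p')) (by
    have e1 : ((p₁ - (a * p' + D * (b * k)) : ℤ) : ℝ) + (k₁ - (a * k + b * p') : ℤ) * β =
        p₁ + k₁ * β - (p' + k * β) * e := by
      rw [h.mul_unit]; push_cast; ring
    have e2 : ((p₁ - (a * p' + D * (b * k)) : ℤ) : ℝ) - (k₁ - (a * k + b * p') : ℤ) * β =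
        p₁ - k₁ * β - (p' - k * β) * (a - b * β) := by
      rw [h.mul_conj]; push_cast; ring
    rw [e1, e2, abs_mul]
    set γ := (p' : ℝ) + k * β
    set γ' := (p' : ℝ) - k * β
    set γ₁ := (p₁ : ℝ) + k₁ * β
    set γ₁' := (p₁ : ℝ) - k₁ * β
    have hγ : 0 < γ := by linarith
    have hγ' : 0 < γ' := by linarith
    have hγ₁' : 0 < γ₁' := by linarith
    have b1 : |γ₁ - γ * e| < (r₂ - r₁) * γ := by
      rw [abs_lt]
      constructor <;> nlinarith
    have b2 : |γ₁' - γ' * (a - b * β)| * γ ≤ e := by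
      rw [← abs_of_pos hγ, ← abs_mul, abs_le]
      constructor
      · have : γ' * (a - b * β) * γ ≤ e * (a - b * β) := by nlinarith
        nlinarith
      · have : γ₁' * γ ≤ γ₁' * γ₁ := mul_le_mul_of_nonneg_left (by nlinarith) hγ₁'.le
        have : 0 < γ' * (a - b * β) * γ := by positivity
        nlinarith
    have b3 : 0 ≤ |γ₁' - γ' * (a - b * β)| := abs_nonneg _
    rcases b3.eq_or_lt with b3 | b3
    · rw [← b3]; simp
    · calc |γ₁ - γ * e| * |γ₁' - γ' * (a - b * β)|
          < ((r₂ - r₁) * γ) * |γ₁' - γ' * (a - b * β)| := mul_lt_mul_of_pos_right b1 b3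
        _ = (r₂ - r₁) * (|γ₁' - γ' * (a - b * β)| * γ) := by ring
        _ ≤ (r₂ - r₁) * e := mul_le_mul_of_nonneg_left b2 (by linarith)
        _ ≤ 1 := hr')
  have hX' : (p₁ : ℝ) = a * p' + D * (b * k) := by exact_mod_cast sub_eq_zero.1 hX
  have hY' : (k₁ : ℝ) = a * k + b * p' := by exact_mod_cast sub_eq_zero.1 hY
  have hb : (b : ℝ) ≠ 0 := by exact_mod_cast h.b_pos.ne'
  have hD : (D : ℝ) ≠ 0 := by rw [← h.sq]; exact (mul_pos h.pos h.pos).ne'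
  refine ⟨p', k, rfl, ?_, ?_, rfl⟩
  · refine mul_left_cancel₀ hb (mul_left_cancel₀ hD ?_)
    linarith
  · refine mul_left_cancel₀ hb ?_
    rw [hY'] at hk₁
    linarith

theorem quad_pow {r₁ r₂ : ℚ} (hr₁ : (r₁ : ℝ) < a + b * β) (hr₂ : (a + b * β : ℝ) < r₂)
    {k : ℕ} {s t : ℤ} (ht : 0 ≤ t) (h1 : ((a : ℝ) + b * β) ^ k = s + t * β)
    (h2 : ((a : ℝ) - b * β) ^ k = s - t * β) :
    Quad D a b β r₁ r₂ s t (s * β) (t * β) := by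
  have he := h.one_lt_unit
  have hc := h.conj_pos
  have hpos : 0 < (s : ℝ) - t * β := h2 ▸ pow_pos hc k
  have hpos' : 0 < (s : ℝ) + t * β := h1 ▸ pow_pos (by linarith) k
  have hn : ((s : ℝ) + t * β) * (s - t * β) = 1 := by
    rw [← h1, ← h2, ← mul_pow, h.unit_mul_conj, one_pow]
  have e1 := h.mul_unit s t
  have e2 := h.mul_conj s t
  have hs : 0 ≤ s := by
    have : (0 : ℝ) < s := by linarith
    exact_mod_cast this.le
  have ha := h.a_pos
  have hb := h.b_pos
  have hmin := h.minimalPoint_of_norm_one (a * s + D * (b * t)) (a * t + b * s) (by positivity)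
    (by push_cast; rw [← e2]; positivity) (by
      push_cast
      rw [← e1, ← e2]
      linear_combination ((a : ℝ) + b * β) * (a - b * β) * hn + h.unit_mul_conj)
  push_cast at hmin
  have e3 : (a : ℝ) * (t * β) + b * (s * β) = (a * t + b * s) * β := by ring
  refine ⟨h.minimalPoint_of_norm_one s t ht hpos hn, ?_, ?_, ?_⟩
  · rwa [e3]
  · rw [e3, ← e1, mul_comm]
    exact mul_lt_mul_of_pos_left hr₁ hpos'
  · rw [e3, ← e1, mul_comm (r₂ : ℝ)]
    exact mul_lt_mul_of_pos_left hr₂ hpos'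

theorem exists_forall_isLeast_self {n : ℤ} (hn : 0 ≤ n) :
    ∃ δ : ℝ, 0 < δ ∧ ∀ g, 0 < g → g < δ → IsLeast (trunc β g n) n := by
  have hβ := h.pos
  have hn' : (0 : ℝ) ≤ n := by exact_mod_cast hn
  refine ⟨min 1 (1 / (2 * n * β + 1)), by positivity, fun g hg hgδ => ⟨⟨hn, 0, by simpa⟩, ?_⟩⟩
  rintro A ⟨hA, j, hj1, hj2⟩
  by_contra hc
  push Not at hc
  have hA' : (0 : ℝ) ≤ A := by exact_mod_cast hA
  have hc' : (0 : ℝ) < n - A := by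
    have : (A : ℝ) < n := by exact_mod_cast hc
    linarith
  have hp := mul_pos hc' hβ
  have g1 : g < 1 := hgδ.trans_le (min_le_left _ _)
  have g2 : g * (2 * n * β + 1) < 1 := by
    rw [← lt_div_iff₀ (by positivity)]
    exact hgδ.trans_le (min_le_right _ _)
  have hne : (j : ℝ) + ((-(n - A) : ℤ) : ℝ) * β ≠ 0 := fun h0 => by
    have := (h.eq_zero_of_mul _ _ h0).2
    omega
  push_cast at hne
  have hnorm := h.one_le_norm j (n - A) (by push_cast; linarith) (by
    push_cast
    refine lt_of_le_of_ne (by linarith) fun h0 => hne (by linarith))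
  push_cast at hnorm
  have hAβ := mul_nonneg hA' hβ.le
  have : ((j : ℝ) + (n - A) * β) * (j - (n - A) * β) ≤ (2 * n * β + 1) * g :=
    mul_le_mul (by nlinarith) (by linarith) (by linarith) (by positivity)
  linarith

theorem isLeast_trunc_le {p q n A : ℤ} (hq : 0 ≤ q) (hp : (q : ℝ) * β < p)
    (hA : IsLeast (trunc β (p - q * β) n) A) :
    2 * (A * β) ≤ (2 + 2 * β) * (p + q * β) := by
  have hβ := h.pos
  have hq' : (0 : ℝ) ≤ q := by exact_mod_cast hq
  have hqβ := mul_nonneg hq' hβ.le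
  set γ := (p : ℝ) + q * β with hγ
  set γ' := (p : ℝ) - q * β with hγ'
  have hγ0 : 0 < γ := by linarith
  have hγ0' : 0 < γ' := by linarith
  have hγγ' : γ' ≤ γ := by linarith
  obtain ⟨i, y, c1, c2, d1, d2⟩ : ∃ x y : ℤ,
      (n * β) / γ' ≤ x - y * β ∧ x - y * β < (n * β) / γ' + 1 ∧
      (n * β - (1 + 2 * β) * γ) / γ ≤ x + y * β ∧
      x + y * β < (n * β - (1 + 2 * β) * γ) / γ + (1 + 2 * β) := by
    set t := (n * β) / γ'
    set s := (n * β - (1 + 2 * β) * γ) / γ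
    refine ⟨⌈t + ⌈(s - t) / (2 * β)⌉ * β⌉, ⌈(s - t) / (2 * β)⌉, ?_⟩
    have l1 := Int.le_ceil ((s - t) / (2 * β))
    have l2 := Int.ceil_lt_add_one ((s - t) / (2 * β))
    set y : ℤ := ⌈(s - t) / (2 * β)⌉
    have l3 := Int.le_ceil (t + y * β)
    have l4 := Int.ceil_lt_add_one (t + y * β)
    set x : ℤ := ⌈t + y * β⌉
    rw [div_le_iff₀ (by positivity)] at l1
    rw [← sub_lt_iff_lt_add, lt_div_iff₀ (by positivity)] at l2
    refine ⟨by linarith, by linarith, by linarith, by linarith⟩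
  rw [div_le_iff₀ hγ0'] at c1
  rw [← sub_lt_iff_lt_add, lt_div_iff₀ hγ0'] at c2
  rw [div_le_iff₀ hγ0] at d1
  rw [← sub_lt_iff_lt_add, lt_div_iff₀ hγ0] at d2
  -- the lattice point `(i + y * β) * (p + q * β) = J - B * β`
  obtain ⟨J, hJ⟩ : ∃ J : ℤ, J = i * p + D * (y * q) := ⟨_, rfl⟩
  obtain ⟨B, hB⟩ : ∃ B : ℤ, B = -(i * q + y * p) := ⟨_, rfl⟩
  have m1 : ((i : ℝ) + y * β) * γ = J - B * β := by
    rw [hγ, hJ, hB]; push_cast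
    linear_combination (y : ℝ) * q * h.sq
  have m2 : ((i : ℝ) - y * β) * γ' = J + B * β := by
    rw [hγ', hJ, hB]; push_cast
    linear_combination (y : ℝ) * q * h.sq
  rw [m1] at d1
  rw [sub_mul, m1] at d2
  rw [m2] at c1
  rw [sub_mul, m2] at c2
  have hB0 : 0 ≤ B := by
    have : (0 : ℝ) ≤ B * β := by linarith
    exact_mod_cast nonneg_of_mul_nonneg_left this hβ
  have hAB : A ≤ B := hA.2 ⟨hB0, J, by linarith, by linarith⟩
  have hAB' : (A : ℝ) * β ≤ B * β :=
    mul_le_mul_of_nonneg_right (by exact_mod_cast hAB) hβ.le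
  linarith

theorem exists_increment_bound : ∃ K : ℤ, ∀ p q n A₀ A₁ : ℤ, 0 ≤ q → (q : ℝ) * β < p →
    ((p : ℝ) + q * β) * (p - q * β) ≤ a + b * β →
    IsLeast (trunc β (p - q * β) n) A₀ →
    IsLeast (trunc β ((a * p + D * (b * q) : ℤ) - (a * q + b * p : ℤ) * β) n) A₁ →
    ∃ N ∈ Finset.Icc 1 K, ∃ X ∈ Finset.Icc (-K) K, ∃ Y ∈ Finset.Icc (-K) K,
      N * (A₁ - A₀) = Y * p - X * q := by
  have hβ := h.pos
  have he := h.one_lt_unit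
  have hc := h.conj_pos
  have hc1 := h.conj_lt_one
  set e := (a : ℝ) + b * β with he'
  obtain ⟨C, hC⟩ : ∃ C : ℝ, C = 1 + (2 + 2 * β) * e := ⟨_, rfl⟩
  have hC0 : 0 < C := by rw [hC]; positivity
  obtain ⟨K, hK⟩ := exists_int_gt (max e (max ((C + 1) * e) (((C + 1) * e) / β)))
  obtain ⟨hK1, hK2, hK3⟩ : e < K ∧ (C + 1) * e < K ∧ (C + 1) * e / β < K := by
    simpa [and_assoc] using hK
  rw [div_lt_iff₀ hβ] at hK3
  refine ⟨K, fun p q n A₀ A₁ hq hp hN h0 h1 => ?_⟩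
  have hq' : (0 : ℝ) ≤ q := by exact_mod_cast hq
  have hqβ := mul_nonneg hq' hβ.le
  have hp0 : 0 ≤ p := by
    have : (0 : ℝ) ≤ p := by linarith
    exact_mod_cast this
  have e1 := h.mul_unit p q
  have e2 := h.mul_conj p q
  rw [← he'] at e1
  have ha := h.a_pos
  have hb := h.b_pos
  set γ := (p : ℝ) + q * β with hγ
  set γ' := (p : ℝ) - q * β with hγ'
  have hγ0 : 0 < γ := by linarith
  have hγ0' : 0 < γ' := by linarith
  have hγγ' : γ' ≤ γ := by linarith
  have bound := h.isLeast_trunc_le (by positivity) (by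
    push_cast
    have : 0 < γ' * (a - b * β) := by positivity
    linarith) h1
  obtain ⟨hA₀, j₀, u0, v0⟩ := h0.1
  obtain ⟨hA₁, j₁, u1, v1⟩ := h1.1
  have e1' : (((a * p + D * (b * q) : ℤ) : ℝ) + (a * q + b * p : ℤ) * β) = γ * e := by
    rw [e1]; push_cast; ring
  have e2' : (((a * p + D * (b * q) : ℤ) : ℝ) - (a * q + b * p : ℤ) * β) =
      γ' * (a - b * β) := by
    rw [e2]; push_cast; ring
  rw [e1'] at bound
  rw [e2'] at v1
  have hlt : γ' * (a - b * β) < γ' := by nlinarith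
  have hle : A₀ ≤ A₁ := h0.2 ⟨hA₁, j₁, u1, by linarith⟩
  have hδ : (0 : ℝ) ≤ (A₁ - A₀) * β :=
    mul_nonneg (by rw [sub_nonneg]; exact_mod_cast hle) hβ.le
  have hA₀' : (0 : ℝ) ≤ A₀ * β := mul_nonneg (by exact_mod_cast hA₀) hβ.le
  obtain ⟨J, hJ⟩ : ∃ J : ℤ, J = j₁ - j₀ := ⟨_, rfl⟩
  obtain ⟨δ, hδ'⟩ : ∃ δ : ℤ, δ = A₁ - A₀ := ⟨_, rfl⟩
  have hJ' : (J : ℝ) = j₁ - j₀ := by rw [hJ]; push_cast; ring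
  have hδ'' : (δ : ℝ) = A₁ - A₀ := by rw [hδ']; push_cast; ring
  rw [← hδ''] at hδ
  have z1 : |(J : ℝ) + δ * β| ≤ γ' := by
    rw [abs_le, hJ', hδ'']
    constructor <;> linarith
  have z2 : |(J : ℝ) - δ * β| ≤ C * γ := by
    have : 2 * (δ * β) ≤ (2 + 2 * β) * (γ * e) := by rw [hδ'']; linarith
    have hCγ : C * γ = γ + (2 + 2 * β) * (γ * e) := by rw [hC]; ring
    rw [abs_le] at z1 ⊢
    rw [hCγ]
    constructor <;> linarith
  obtain ⟨X, hX⟩ : ∃ X : ℤ, X = J * p + D * (δ * q) := ⟨_, rfl⟩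
  obtain ⟨Y, hY⟩ : ∃ Y : ℤ, Y = J * q + δ * p := ⟨_, rfl⟩
  have w1 : |(X : ℝ) + Y * β| ≤ e := by
    have : (X : ℝ) + Y * β = (J + δ * β) * γ := by
      rw [hX, hY, hγ]; push_cast
      linear_combination -(δ : ℝ) * q * h.sq
    rw [this, abs_mul, abs_of_pos hγ0, mul_comm]
    exact (mul_le_mul_of_nonneg_left z1 hγ0.le).trans hN
  have w2 : |(X : ℝ) - Y * β| ≤ C * e := by
    have : (X : ℝ) - Y * β = (J - δ * β) * γ' := by
      rw [hX, hY, hγ']; push_cast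
      linear_combination -(δ : ℝ) * q * h.sq
    rw [this, abs_mul, abs_of_pos hγ0']
    calc |(J : ℝ) - δ * β| * γ' ≤ C * γ * γ' := mul_le_mul_of_nonneg_right z2 hγ0'.le
      _ = C * (γ * γ') := by ring
      _ ≤ C * e := mul_le_mul_of_nonneg_left hN hC0.le
  rw [abs_le] at w1 w2
  have hCe : 0 < C * e := by positivity
  have hNint : γ * γ' = ((p * p - D * (q * q) : ℤ) : ℝ) := h.norm_eq p q
  refine ⟨p * p - D * (q * q), ?_, X, ?_, Y, ?_, ?_⟩
  · rw [Finset.mem_Icc]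
    constructor
    · have := h.one_le_norm p q hγ0 hγ0'
      rw [hNint] at this
      exact_mod_cast this
    · rw [hNint] at hN
      exact_mod_cast (hN.trans hK1.le)
  · rw [Finset.mem_Icc]
    have k1 : (X : ℝ) ≤ K := by linarith
    have k2 : -(K : ℝ) ≤ X := by linarith
    exact ⟨by exact_mod_cast k2, by exact_mod_cast k1⟩
  · rw [Finset.mem_Icc]
    have k1 : (Y : ℝ) ≤ K := le_of_mul_le_mul_right (by linarith) hβ
    have k2 : -(K : ℝ) ≤ Y := le_of_mul_le_mul_right (by linarith) hβ
    exact ⟨by exact_mod_cast k2, by exact_mod_cast k1⟩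
  · rw [← hδ', hX, hY]
    ring

theorem leastTrunc_int_iff {g : ℝ} {n : ℤ} {x : ℝ} :
    LeastTrunc IsInt (IsMul β) D (β * g) n x ↔ ∃ A : ℤ, x = A ∧ IsLeast (trunc β g n) A := by
  have hβ := h.pos
  have key : ∀ A : ℤ, (∃ j, IsMul β j ∧ (D : ℝ) * (n - A) ≤ j ∧ j < D * (n - A) + β * g) ↔
      ∃ j : ℤ, (n - A) * β ≤ j ∧ j < (n - A) * β + g := by
    intro A
    have e : (D : ℝ) * (n - A) = ((n - A) * β) * β := by rw [← h.sq]; ring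
    constructor
    · rintro ⟨_, ⟨j, rfl⟩, h1, h2⟩
      rw [e] at h1 h2
      exact ⟨j, le_of_mul_le_mul_right h1 hβ, lt_of_mul_lt_mul_right (by linarith) hβ.le⟩
    · rintro ⟨j, h1, h2⟩
      rw [e]
      exact ⟨_, ⟨j, rfl⟩, mul_le_mul_of_nonneg_right h1 hβ.le,
        by linarith [mul_lt_mul_of_pos_right h2 hβ]⟩
  constructor
  · rintro ⟨⟨A, rfl⟩, h0, h1, h2⟩
    refine ⟨A, rfl, ⟨by exact_mod_cast h0, (key A).1 h1⟩, fun A' hA' => ?_⟩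
    exact_mod_cast h2 A' ⟨A', rfl⟩ (by exact_mod_cast hA'.1) ((key A').2 hA'.2)
  · rintro ⟨A, rfl, h1, h2⟩
    refine ⟨⟨A, rfl⟩, by exact_mod_cast h1.1, (key A).2 h1.2, ?_⟩
    rintro _ ⟨A', rfl⟩ h3 h4
    exact_mod_cast h2 ⟨by exact_mod_cast h3, (key A').1 h4⟩

theorem leastTrunc_mul_iff {g : ℝ} {n : ℤ} {x : ℝ} :
    LeastTrunc (IsMul β) IsInt 1 g (n * β) x ↔
      ∃ A : ℤ, x = A * β ∧ IsLeast (trunc β g n) A := by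
  have hβ := h.pos
  have key : ∀ A : ℤ, (∃ j, IsInt j ∧ ((1 : ℤ) : ℝ) * (n * β - A * β) ≤ j ∧
      j < ((1 : ℤ) : ℝ) * (n * β - A * β) + g) ↔
      ∃ j : ℤ, (n - A) * β ≤ j ∧ j < (n - A) * β + g := by
    intro A
    have e : ((1 : ℤ) : ℝ) * (n * β - A * β) = (n - A) * β := by push_cast; ring
    rw [e]
    constructor
    · rintro ⟨_, ⟨j, rfl⟩, h1⟩
      exact ⟨j, h1⟩
    · rintro ⟨j, h1⟩
      exact ⟨_, ⟨j, rfl⟩, h1⟩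
  have pos : ∀ A : ℤ, 0 ≤ (A : ℝ) * β ↔ 0 ≤ A := fun A => by
    rw [mul_nonneg_iff_of_pos_right hβ]; exact_mod_cast Iff.rfl
  constructor
  · rintro ⟨⟨A, rfl⟩, h0, h1, h2⟩
    refine ⟨A, rfl, ⟨(pos A).1 h0, (key A).1 h1⟩, fun A' hA' => ?_⟩
    exact_mod_cast le_of_mul_le_mul_right
      (h2 (A' * β) ⟨A', rfl⟩ ((pos A').2 hA'.1) ((key A').2 hA'.2)) hβ
  · rintro ⟨A, rfl, h1, h2⟩
    refine ⟨⟨A, rfl⟩, (pos A).2 h1.1, (key A).2 h1.2, ?_⟩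
    rintro _ ⟨A', rfl⟩ h3 h4
    have := h2 ⟨(pos A').1 h3, (key A').1 h4⟩
    exact mul_le_mul_of_nonneg_right (by exact_mod_cast this) hβ.le

theorem exists_mulGraph_iff : ∃ (r₁ r₂ : ℚ) (K : ℤ), ∀ n y : ℝ,
    MulGraph D a b β r₁ r₂ K n y ↔ IsInt n ∧ 0 ≤ n ∧ y = n * β := by
  have hβ := h.pos
  have he := h.one_lt_unit
  have hc := h.conj_pos
  have hc1 := h.conj_lt_one
  have hec := h.unit_mul_conj
  set e := (a : ℝ) + b * β with he'
  obtain ⟨r₁, hr, hr₁⟩ := exists_rat_btwn (show max 1 (e - 1 / (2 * e)) < e from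
    max_lt he (by linarith [show 0 < 1 / (2 * e) by positivity]))
  obtain ⟨r₂, hr₂, hr₂'⟩ := exists_rat_btwn (show e < e + 1 / (2 * e) by
    linarith [show 0 < 1 / (2 * e) by positivity])
  rw [max_lt_iff] at hr
  have hr' : ((r₂ : ℝ) - r₁) * e ≤ 1 := by
    have h1 : (r₂ : ℝ) - r₁ ≤ 1 / e := by
      have : 1 / e = 1 / (2 * e) + 1 / (2 * e) := by field_simp; norm_num
      linarith
    calc _ ≤ 1 / e * e := mul_le_mul_of_nonneg_right h1 (by linarith)
      _ = 1 := by field_simp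
  have hr1 : 1 ≤ r₁ := by exact_mod_cast hr.1.le
  obtain ⟨K, hK⟩ := h.exists_increment_bound
  have g0 : ∀ p q : ℤ, (p * β - D * q : ℝ) = β * (p - q * β) := fun p q => by
    rw [← h.sq]; ring
  have g1 : ∀ p q : ℤ, (a * (p * β) + D * (b * (q * β)) - D * (b * p + a * q) : ℝ) =
      β * ((a * p + D * (b * q) : ℤ) - (a * q + b * p : ℤ) * β) := fun p q => by
    rw [← h.sq]; push_cast; ring_nf; rw [show β ^ 3 = β * β * β by ring, h.sq]; ring_nf
  have g2 : ∀ p q : ℤ, (a * p + D * (b * q) - (a * (q * β) + b * (p * β)) : ℝ) =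
      (a * p + D * (b * q) : ℤ) - (a * q + b * p : ℤ) * β := fun p q => by
    push_cast; ring
  refine ⟨r₁, r₂, K, fun n y => ⟨?_, ?_⟩⟩
  · rintro ⟨⟨n, rfl⟩, hn, ⟨m, rfl⟩, hm, H⟩
    refine ⟨⟨n, rfl⟩, hn, ?_⟩
    have hn' : 0 ≤ n := by exact_mod_cast hn
    have hm' : 0 ≤ m := by exact_mod_cast nonneg_of_mul_nonneg_left hm hβ
    have step : ∀ k : ℕ, ∀ A B : ℤ, IsLeast (trunc β ((a - b * β) ^ k) n) A →
        IsLeast (trunc β ((a - b * β) ^ k) m) B → A = B := by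
      intro k
      induction k with
      | zero =>
        intro A B hA hB
        rw [pow_zero] at hA hB
        rw [isLeast_trunc_one hA, isLeast_trunc_one hB]
      | succ k ih =>
        intro A B hA hB
        obtain ⟨s, t, ht, hs1, hs2⟩ := h.exists_pow k
        obtain ⟨A₀, A₁, z₀, z₁, l1, l2, l3, l4, N, hN, X, -, Y, -, f1, f2⟩ :=
          H s t (s * β) (t * β) (h.quad_pow hr₁ hr₂ ht hs1 hs2)
        have hs3 : (a - b * β) ^ (k + 1) =
            ((a * s + D * (b * t) : ℤ) : ℝ) - (a * t + b * s : ℤ) * β := by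
          rw [pow_succ, hs2, h.mul_conj]; push_cast; ring
        rw [g0, h.leastTrunc_int_iff, ← hs2] at l1
        rw [g1, h.leastTrunc_int_iff, ← hs3] at l2
        rw [h.leastTrunc_mul_iff, ← hs2] at l3
        rw [g2, h.leastTrunc_mul_iff, ← hs3] at l4
        obtain ⟨A₀, rfl, l1⟩ := l1
        obtain ⟨A₁, rfl, l2⟩ := l2
        obtain ⟨B₀, rfl, l3⟩ := l3
        obtain ⟨B₁, rfl, l4⟩ := l4
        rw [hA.unique l2, hB.unique l4]
        have hAB := ih A₀ B₀ l1 l3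
        subst hAB
        have hN0 : (N : ℝ) * β ≠ 0 := by
          have : N ≠ 0 := by have := (Finset.mem_Icc.1 hN).1; omega
          exact mul_ne_zero (by exact_mod_cast this) hβ.ne'
        have : (A₁ : ℝ) = B₁ := mul_left_cancel₀ hN0 (by linear_combination β * f1 - f2)
        exact_mod_cast this
    obtain ⟨δ, hδ, H1⟩ := h.exists_forall_isLeast_self hn'
    obtain ⟨δ', hδ', H2⟩ := h.exists_forall_isLeast_self hm'
    obtain ⟨k, hk⟩ := exists_pow_lt_of_lt_one (lt_min hδ hδ') hc1
    rw [lt_min_iff] at hk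
    rw [step k n m (H1 _ (pow_pos hc k) hk.1) (H2 _ (pow_pos hc k) hk.2)]
  · rintro ⟨⟨n, rfl⟩, hn, rfl⟩
    refine ⟨⟨n, rfl⟩, hn, ⟨n, rfl⟩, mul_nonneg hn hβ.le, ?_⟩
    intro p q P R hQ
    have hn' : 0 ≤ n := by exact_mod_cast hn
    have hnorm := h.norm_le_of_minimalPoint hQ.1
    have hm := hQ.1
    have hm₁ := hQ.2.1
    obtain ⟨p, q, rfl, rfl, rfl, rfl⟩ := h.quad_eq hr1 hr₁ hr₂ hr' hQ
    have hq : 0 ≤ q := by exact_mod_cast nonneg_of_mul_nonneg_left hm.2.2.1 hβ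
    have hpq := hm.2.2.2.1
    have hpq₁ := hm₁.2.2.2.1
    obtain ⟨A₀, hA₀⟩ := exists_isLeast_trunc (β := β) (sub_pos.2 hpq) hn'
    obtain ⟨A₁, hA₁⟩ := exists_isLeast_trunc (β := β) ((g2 p q) ▸ sub_pos.2 hpq₁) hn'
    obtain ⟨N, hN, X, hX, Y, hY, hXY⟩ := hK p q n A₀ A₁ hq hpq hnorm hA₀ hA₁
    have hXY' : (N : ℝ) * (A₁ - A₀) = Y * p - X * q := by exact_mod_cast hXY
    refine ⟨A₀, A₁, A₀ * β, A₁ * β, ?_, ?_, ?_, ?_, N, hN, X, hX, Y, hY, hXY', ?_⟩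
    · rw [g0, h.leastTrunc_int_iff]
      exact ⟨A₀, rfl, hA₀⟩
    · rw [g1, h.leastTrunc_int_iff]
      exact ⟨A₁, rfl, hA₁⟩
    · rw [h.leastTrunc_mul_iff]
      exact ⟨A₀, rfl, hA₀⟩
    · rw [g2, h.leastTrunc_mul_iff]
      exact ⟨A₁, rfl, hA₁⟩
    · linear_combination β * hXY'

end PellBase

theorem PellBase.eq_mul_iff {D a b : ℤ} {β : ℝ} (h : PellBase D a b β) (x y : ℝ) :
    y = β * x ↔ ∀ g g', (∃ n, ∃ n', ∃ m, ∃ m', (IsInt n ∧ n' = n * β) ∧ (IsInt m ∧ m' = m * β) ∧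
      g = n + m' ∧ g' = n' + D * m) → (g < x → g' ≤ y) ∧ (x < g → y ≤ g') := by
  have hβ := h.pos
  constructor
  · rintro rfl _ _ ⟨_, _, _, _, ⟨⟨n, rfl⟩, rfl⟩, ⟨⟨m, rfl⟩, rfl⟩, rfl, rfl⟩
    have e : (n : ℝ) * β + D * m = β * (n + m * β) := by rw [← h.sq]; ring
    rw [e]
    exact ⟨fun hl => mul_le_mul_of_nonneg_left hl.le hβ.le,
      fun hl => mul_le_mul_of_nonneg_left hl.le hβ.le⟩
  · intro H
    have hd : Dense (AddSubgroup.closure {β, 1} : Set ℝ) :=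
      dense_addSubgroupClosure_pair_iff.2 (by simpa using h.irr)
    have key : ∀ g ∈ AddSubgroup.closure {β, 1}, (g < x → β * g ≤ y) ∧ (x < g → y ≤ β * g) := by
      intro g hg
      obtain ⟨m, n, rfl⟩ := AddSubgroup.mem_closure_pair.1 hg
      refine H _ _ ⟨n, n * β, m, m * β, ⟨⟨n, rfl⟩, rfl⟩, ⟨⟨m, rfl⟩, rfl⟩, ?_, ?_⟩
      · simp; ring
      · rw [← h.sq]; simp; ring
    rcases lt_trichotomy y (β * x) with hlt | heq | hlt
    · exfalso
      have : y / β < x := by rwa [div_lt_iff₀ hβ, mul_comm]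
      obtain ⟨g, hg, h1, h2⟩ := hd.exists_between this
      have := (key g hg).1 h2
      rw [div_lt_iff₀ hβ] at h1
      linarith
    · exact heq
    · exfalso
      have : x < y / β := by rwa [lt_div_iff₀ hβ, mul_comm]
      obtain ⟨g, hg, h1, h2⟩ := hd.exists_between this
      have := (key g hg).2 h1
      rw [lt_div_iff₀ hβ] at h2
      linarith

section Definability

variable {d : ℚ} {D a b : ℤ} {β : ℝ} {ι : Type}

theorem dfn_minimalPoint
    (hB : ∀ {ι : Type} {f : (ι → ℝ) → ℝ}, DFun d f → Dfn d fun v => IsMul β (f v))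
    {p y : (ι → ℝ) → ℝ} (hp : DFun d p) (hy : DFun d y) :
    Dfn d fun v => MinimalPoint β (p v) (y v) := by
  have hp' := hp.weaken.weaken
  have hy' := hy.weaken.weaken
  refine hp.isInt.and ((hB hy).and ((DFun.zero.le hy).and ((hy.lt hp).and
    (Dfn.all (Dfn.all ?_)))))
  exact (DFun.var _).isInt.imp ((hB (DFun.var _)).imp (((DFun.var _).neg.lt (DFun.var _)).imp
    (((DFun.var _).lt (DFun.var _)).imp ((((DFun.var _).add (DFun.var _)).le (hp'.add hy')).imp
      ((hp'.sub hy').le ((DFun.var _).sub (DFun.var _)))))))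

theorem dfn_leastTrunc {S T : ℝ → Prop} {c : ℤ}
    (hS : ∀ {ι : Type} {f : (ι → ℝ) → ℝ}, DFun d f → Dfn d fun v => S (f v))
    (hT : ∀ {ι : Type} {f : (ι → ℝ) → ℝ}, DFun d f → Dfn d fun v => T (f v))
    {g n A : (ι → ℝ) → ℝ} (hg : DFun d g) (hn : DFun d n) (hA : DFun d A) :
    Dfn d fun v => LeastTrunc S T c (g v) (n v) (A v) := by
  have key : ∀ {ι : Type} {g n A : (ι → ℝ) → ℝ}, DFun d g → DFun d n → DFun d A →
      Dfn d fun v => ∃ j, T j ∧ c * (n v - A v) ≤ j ∧ j < c * (n v - A v) + g v := by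
    intro ι g n A hg hn hA
    have := (hn.sub hA).weaken.intMul c
    exact Dfn.ex ((hT (DFun.var _)).and ((this.le (DFun.var _)).and
      ((DFun.var _).lt (this.add hg.weaken))))
  refine (hS hA).and ((DFun.zero.le hA).and ((key hg hn hA).and (Dfn.all ?_)))
  exact (hS (DFun.var _)).imp ((DFun.zero.le (DFun.var _)).imp
    ((key hg.weaken hn.weaken (DFun.var _)).imp (hA.weaken.le (DFun.var _))))

theorem dfn_quad {r₁ r₂ : ℚ}
    (hB : ∀ {ι : Type} {f : (ι → ℝ) → ℝ}, DFun d f → Dfn d fun v => IsMul β (f v))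
    {p q P R : (ι → ℝ) → ℝ} (hp : DFun d p) (hq : DFun d q) (hP : DFun d P) (hR : DFun d R) :
    Dfn d fun v => Quad D a b β r₁ r₂ (p v) (q v) (P v) (R v) := by
  have h₁ := (hp.intMul a).add ((hq.intMul b).intMul D)
  have h₂ := (hR.intMul a).add (hP.intMul b)
  exact (dfn_minimalPoint hB hp hR).and ((dfn_minimalPoint hB h₁ h₂).and
    ((((hp.add hR).ratMul r₁).lt (h₁.add h₂)).and ((h₁.add h₂).lt ((hp.add hR).ratMul r₂))))

theorem dfn_mulGraph {r₁ r₂ : ℚ} {K : ℤ}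
    (hB : ∀ {ι : Type} {f : (ι → ℝ) → ℝ}, DFun d f → Dfn d fun v => IsMul β (f v))
    {n y : (ι → ℝ) → ℝ} (hn : DFun d n) (hy : DFun d y) :
    Dfn d fun v => MulGraph D a b β r₁ r₂ K (n v) (y v) := by
  have hI : ∀ {ι : Type} {f : (ι → ℝ) → ℝ}, DFun d f → Dfn d fun v => IsInt (f v) :=
    fun hf => hf.isInt
  refine hn.isInt.and ((DFun.zero.le hn).and ((hB hy).and ((DFun.zero.le hy).and
    (Dfn.all (Dfn.all (Dfn.all (Dfn.all ((dfn_quad hB (DFun.var _) (DFun.var _) (DFun.var _)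
      (DFun.var _)).imp (Dfn.ex (Dfn.ex (Dfn.ex (Dfn.ex ?_))))))))))))
  have hn' := hn.weaken.weaken.weaken.weaken.weaken.weaken.weaken.weaken
  have hy' := hy.weaken.weaken.weaken.weaken.weaken.weaken.weaken.weaken
  refine (dfn_leastTrunc hI hB ((DFun.var _).sub ((DFun.var _).intMul D)) hn' (DFun.var _)).and
    ((dfn_leastTrunc hI hB ((((DFun.var _).intMul a).add (((DFun.var _).intMul b).intMul D)).sub
      ((((DFun.var _).intMul b).add ((DFun.var _).intMul a)).intMul D)) hn' (DFun.var _)).and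
    ((dfn_leastTrunc hB hI ((DFun.var _).sub (DFun.var _)) hy' (DFun.var _)).and
    ((dfn_leastTrunc hB hI ((((DFun.var _).intMul a).add (((DFun.var _).intMul b).intMul D)).sub
      (((DFun.var _).intMul a).add ((DFun.var _).intMul b))) hy' (DFun.var _)).and
    (Dfn.exFinset _ fun N => Dfn.exFinset _ fun X => Dfn.exFinset _ fun Y => ?_))))
  exact ((((DFun.var _).sub (DFun.var _)).intMul N).eq (((DFun.var _).intMul Y).sub
      ((DFun.var _).intMul X))).and
    ((((DFun.var _).sub (DFun.var _)).intMul N).eq (((DFun.var _).intMul Y).sub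
      ((DFun.var _).intMul X)))

theorem PellBase.dfn_eq_mul (h : PellBase D a b β)
    (hB : ∀ {ι : Type} {f : (ι → ℝ) → ℝ}, DFun d f → Dfn d fun v => IsMul β (f v))
    {x y : (ι → ℝ) → ℝ} (hx : DFun d x) (hy : DFun d y) :
    Dfn d fun v => y v = β * x v := by
  obtain ⟨r₁, r₂, K, H⟩ := h.exists_mulGraph_iff
  have key : ∀ {ι : Type} {n n' : (ι → ℝ) → ℝ}, DFun d n → DFun d n' →
      Dfn d fun v => IsInt (n v) ∧ n' v = n v * β := by
    intro ι n n' hn hn'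
    have graph : ∀ {m m' : (ι → ℝ) → ℝ}, DFun d m → DFun d m' →
        Dfn d fun v => MulGraph D a b β r₁ r₂ K (m v) (m' v) := fun hm hm' =>
      dfn_mulGraph hB hm hm'
    refine ((graph hn hn').or (graph hn.neg hn'.neg)).congr fun v => ?_
    rw [H, H]
    have e : IsInt (-n v) ↔ IsInt (n v) := by
      constructor
      · rintro ⟨z, hz⟩
        exact ⟨-z, by push_cast; linarith⟩
      · rintro ⟨z, hz⟩
        exact ⟨-z, by push_cast; linarith⟩
    rw [e, neg_mul, neg_inj, neg_nonneg]
    have := le_total 0 (n v)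
    tauto
  refine Dfn.congr ?_ fun v => (h.eq_mul_iff (x v) (y v)).symm
  refine Dfn.all (Dfn.all (Dfn.imp (Dfn.ex (Dfn.ex (Dfn.ex (Dfn.ex ((key (DFun.var _)
    (DFun.var _)).and ((key (DFun.var _) (DFun.var _)).and (((DFun.var _).eq
    ((DFun.var _).add (DFun.var _))).and ((DFun.var _).eq ((DFun.var _).add
    ((DFun.var _).intMul D))))))))))  ?_))
  have hx' := hx.weaken.weaken
  have hy' := hy.weaken.weaken
  exact (((DFun.var _).lt hx').imp ((DFun.var _).le hy')).and
    ((hx'.lt (DFun.var _)).imp (hy'.le (DFun.var _)))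

end Definability

theorem dfn_eq_sqrt_mul {d : ℚ} (hd : 0 ≤ d) {ι : Type} {x y : (ι → ℝ) → ℝ}
    (hx : DFun d x) (hy : DFun d y) : Dfn d fun v => y v = √d * x v := by
  have hden : (0 : ℝ) < d.den := by exact_mod_cast d.den_pos
  obtain ⟨D, hD⟩ : ∃ D : ℤ, D = d.num * d.den := ⟨_, rfl⟩
  have hsq : (d.den * √d) * (d.den * √d) = (D : ℝ) := by
    have h1 : √(d : ℝ) * √d = d := Real.mul_self_sqrt (by exact_mod_cast hd)
    have h2 : (d : ℝ) * d.den = d.num := by exact_mod_cast d.mul_den_eq_num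
    calc _ = (d.den : ℝ) * d.den * (√(d : ℝ) * √d) := by ring
      _ = (d * d.den) * d.den := by rw [h1]; ring
      _ = D := by rw [h2, hD]; push_cast; ring
  have hnn : 0 ≤ d.den * √(d : ℝ) := by positivity
  have hsqrt : d.den * √(d : ℝ) = √(D : ℝ) := by rw [← hsq, Real.sqrt_mul_self hnn]
  suffices H : Dfn d fun v => d.den * y v = (d.den * √(d : ℝ)) * x v by
    refine H.congr fun v => ?_
    rw [mul_assoc]
    exact mul_right_inj' hden.ne'
  have hD0 : 0 ≤ D := by
    have := mul_self_nonneg (d.den * √(d : ℝ))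
    rw [hsq] at this
    exact_mod_cast this
  by_cases hs : IsSquare D
  · obtain ⟨r, rfl⟩ := hs
    have hr : d.den * √(d : ℝ) = ((|r| : ℤ) : ℝ) := by
      rw [hsqrt]; push_cast; rw [Real.sqrt_mul_self_eq_abs]
    rw [hr]
    exact (hy.natMul _).eq (hx.intMul _)
  · have hDpos : 0 < D := lt_of_le_of_ne hD0 fun h0 => hs (h0 ▸ ⟨0, rfl⟩)
    obtain ⟨s, h1, h2⟩ := Pell.Solution₁.exists_pos_of_not_isSquare hDpos hs
    have hP : PellBase D s.x s.y (d.den * √d) :=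
      { pos := hnn.lt_of_ne fun h0 => by
          rw [← h0, zero_mul] at hsq
          exact hDpos.ne (by exact_mod_cast hsq)
        sq := hsq
        irr := by
          rw [hsqrt]
          exact (irrational_sqrt_intCast_iff_of_nonneg hD0).2 hs
        a_pos := by omega
        b_pos := h2
        pell := by linarith [s.prop, sq s.x, sq s.y] }
    refine hP.dfn_eq_mul (fun {κ f} hf => ?_) hx (hy.natMul _)
    refine (Dfn.ex (Q := fun v x => (∃ z : ℤ, x = z * √(d : ℝ)) ∧ f v = d.den * x)
      ((DFun.var _).isSqrt.and (hf.weaken.eq ((DFun.var _).natMul _)))).congr fun v => ?_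
    constructor
    · rintro ⟨_, ⟨z, rfl⟩, hz⟩
      exact ⟨z, by rw [hz]; ring⟩
    · rintro ⟨z, hz⟩
      exact ⟨_, ⟨z, rfl⟩, by rw [hz]; ring⟩

theorem theorem_D (d : ℚ) (hd : 0 ≤ d) :
    letI := rStruc d
    Set.Definable₂ (∅ : Set ℝ) rLang
      {p : ℝ × ℝ | p.2 = Real.sqrt d * p.1} := by
  obtain ⟨φ, hφ⟩ := dfn_eq_sqrt_mul hd (DFun.var (0 : Fin 2)) (DFun.var (1 : Fin 2))
  let _ := rStruc d
  exact Set.empty_definable_iff.2 ⟨φ, Set.ext fun v => (hφ v).symm⟩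
end

section
/- Let d be a positive rational that is not the square of a rational, with continued fraction expansion √d = [a₀; a₁, a₂, …] of minimal period length m, and convergent numerators pₖ and denominators qₖ. Then there exist rational numbers v₀,…,v_{m−1} and w₀,…,w_{m−1} such that for every i ∈ {0,…,m−1} and every k ≥ 1: q_{km+i} = vᵢ·p_{km+i+1} + wᵢ·p_{km+i}. -/
open Real

/-- The sequence of complete quotients of `a`: `ζ₀ = a`, `ζ_{k+1} = 1/(ζₖ - ⌊ζₖ⌋)`. -/
noncomputable def cfZeta (a : ℝ) : ℕ → ℝ
  | 0 => a
  | k + 1 => (cfZeta a k - ⌊cfZeta a k⌋)⁻¹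

/-- The partial quotients of the continued fraction expansion `[a₀; a₁, a₂, …]` of `a`. -/
noncomputable def cfA (a : ℝ) (k : ℕ) : ℤ := ⌊cfZeta a k⌋

/-- Denominators of the convergents, shifted by one: `cfQ a (k+1) = qₖ`, with
`q₋₁ = 0`, `q₀ = 1` and `q_{k+1} = a_{k+1}·qₖ + q_{k-1}`. -/
noncomputable def cfQ (a : ℝ) : ℕ → ℤ
  | 0 => 0
  | 1 => 1
  | k + 2 => cfA a (k + 1) * cfQ a (k + 1) + cfQ a k

/-- Numerators of the convergents, shifted by one: `cfP a (k+1) = pₖ`, with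
`p₋₁ = 1`, `p₀ = a₀` and `p_{k+1} = a_{k+1}·pₖ + p_{k-1}`. -/
noncomputable def cfP (a : ℝ) : ℕ → ℤ
  | 0 => 1
  | 1 => cfA a 0
  | k + 2 => cfA a (k + 1) * cfP a (k + 1) + cfP a k

/-- The `k`-th difference `βₖ = qₖ·a − pₖ`. -/
noncomputable def cfBeta (a : ℝ) (k : ℕ) : ℝ := (cfQ a (k + 1) : ℝ) * a - (cfP a (k + 1) : ℝ)

/-- `m` is the length of the minimal period of the continued fraction expansion of `a`
(periodicity from index 1 onward). -/
def IsMinPeriod (a : ℝ) (m : ℕ) : Prop :=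
  0 < m ∧ (∀ k, 1 ≤ k → cfA a (k + m) = cfA a k) ∧
    ∀ m', 0 < m' → (∀ k, 1 ≤ k → cfA a (k + m') = cfA a k) → m ≤ m'

theorem irrational_sqrt_ratCast_of_not_sq {d : ℚ} (hd : 0 < d) (hnsq : ¬ ∃ c : ℚ, c ^ 2 = d) :
    Irrational (Real.sqrt d) := by
  rintro ⟨c, hc⟩
  refine hnsq ⟨c, ?_⟩
  have h : ((c : ℝ)) ^ 2 = d := by
    rw [hc]
    exact Real.sq_sqrt (by exact_mod_cast hd.le)
  exact_mod_cast h

theorem irrational_cfZeta {a : ℝ} (ha : Irrational a) (n : ℕ) : Irrational (cfZeta a n) := by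
  induction n with
  | zero => exact ha
  | succ n ih => exact (ih.sub_intCast _).inv

theorem cfZeta_sub_cfA_pos {a : ℝ} (ha : Irrational a) (n : ℕ) :
    0 < cfZeta a n - cfA a n := by
  have h := irrational_cfZeta ha n
  exact sub_pos.mpr (lt_of_le_of_ne (Int.floor_le _) (h.ne_int _).symm)

theorem cfZeta_sub_mul_succ {a : ℝ} (ha : Irrational a) (n : ℕ) :
    (cfZeta a n - cfA a n) * cfZeta a (n + 1) = 1 :=
  mul_inv_cancel₀ (cfZeta_sub_cfA_pos ha n).ne'

theorem one_lt_cfZeta_succ {a : ℝ} (ha : Irrational a) (n : ℕ) : 1 < cfZeta a (n + 1) :=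
  (one_lt_inv₀ (cfZeta_sub_cfA_pos ha n)).mpr
    (sub_left_lt_of_lt_add (Int.lt_floor_add_one (cfZeta a n)))

theorem two_lt_cfZeta_mul_succ {a : ℝ} (ha : Irrational a) (n : ℕ) :
    2 < cfZeta a (n + 1) * cfZeta a (n + 2) := by
  have h := cfZeta_sub_mul_succ ha (n + 1)
  have h1 : (1 : ℝ) ≤ cfA a (n + 1) := by
    exact_mod_cast Int.le_floor.mpr (by exact_mod_cast (one_lt_cfZeta_succ ha n).le)
  nlinarith [one_lt_cfZeta_succ ha (n + 1)]

theorem abs_cfZeta_sub_lt_one {a : ℝ} {i j : ℕ} (h : cfA a i = cfA a j) :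
    |cfZeta a i - cfZeta a j| < 1 :=
  Int.abs_sub_lt_one_of_floor_eq_floor h

/-- Complete quotients with the same floor contract towards each other. -/
theorem abs_cfZeta_sub_mul {a : ℝ} (ha : Irrational a) {i j : ℕ} (h : cfA a i = cfA a j) :
    |cfZeta a i - cfZeta a j| * (cfZeta a (i + 1) * cfZeta a (j + 1)) =
      |cfZeta a (i + 1) - cfZeta a (j + 1)| := by
  have hi := cfZeta_sub_mul_succ ha i
  have hj := cfZeta_sub_mul_succ ha j
  have pi := one_lt_cfZeta_succ ha i
  have pj := one_lt_cfZeta_succ ha j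
  rw [h] at hi
  have hpos : 0 < cfZeta a (i + 1) * cfZeta a (j + 1) := by positivity
  rw [← abs_of_pos hpos, ← abs_mul, abs_sub_comm (cfZeta a (i + 1))]
  congr 1
  linear_combination cfZeta a (j + 1) * hi - cfZeta a (i + 1) * hj

/-- The partial quotients determine the complete quotients. -/
theorem cfZeta_eq_of_cfA_eq {a : ℝ} (ha : Irrational a) {i j : ℕ}
    (h : ∀ n, cfA a (i + n) = cfA a (j + n)) : cfZeta a i = cfZeta a j := by
  have step : ∀ n, 4 * |cfZeta a (i + n) - cfZeta a (j + n)| ≤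
      |cfZeta a (i + (n + 2)) - cfZeta a (j + (n + 2))| := by
    intro n
    have e1 := abs_cfZeta_sub_mul ha (h n)
    have e2 := abs_cfZeta_sub_mul ha (h (n + 1))
    have hi := two_lt_cfZeta_mul_succ ha (i + n)
    have hj := two_lt_cfZeta_mul_succ ha (j + n)
    simp only [← add_assoc] at e1 e2 ⊢
    rw [← e2, ← e1]
    have h4 : 4 ≤ (cfZeta a (i + n + 1) * cfZeta a (i + n + 2)) *
        (cfZeta a (j + n + 1) * cfZeta a (j + n + 2)) := by nlinarith
    have := mul_le_mul_of_nonneg_left h4 (abs_nonneg (cfZeta a (i + n) - cfZeta a (j + n)))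
    linear_combination this
  have bound : ∀ n, 4 ^ n * |cfZeta a i - cfZeta a j| ≤
      |cfZeta a (i + 2 * n) - cfZeta a (j + 2 * n)| := by
    intro n
    induction n with
    | zero => simp
    | succ n ih =>
      have := step (2 * n)
      rw [pow_succ, mul_add_one]
      linarith
  by_contra hne
  have hpos : 0 < |cfZeta a i - cfZeta a j| := abs_pos.mpr (sub_ne_zero.mpr hne)
  obtain ⟨n, hn⟩ := pow_unbounded_of_one_lt (|cfZeta a i - cfZeta a j|)⁻¹
    (by norm_num : (1 : ℝ) < 4)
  have h1 := (inv_lt_iff_one_lt_mul₀ hpos).mp hn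
  linarith [bound n, abs_cfZeta_sub_lt_one (h (2 * n))]

theorem cfQ_mul_sub_cfP_succ {a : ℝ} (ha : Irrational a) (n : ℕ) :
    (cfQ a (n + 1) * a - cfP a (n + 1)) * cfZeta a (n + 1) = -(cfQ a n * a - cfP a n) := by
  induction n with
  | zero =>
    have := cfZeta_sub_mul_succ ha 0
    simpa [cfQ, cfP, cfZeta] using this
  | succ n ih =>
    have h := cfZeta_sub_mul_succ ha (n + 1)
    simp only [cfQ, cfP]
    push_cast
    linear_combination -(cfQ a (n + 1) * a - cfP a (n + 1)) * h + cfZeta a (n + 2) * ih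

theorem cfQ_mul_sub_cfP_add_period {a : ℝ} (ha : Irrational a) {M : ℕ}
    (hM : ∀ k, 1 ≤ k → cfA a (k + M) = cfA a k) (n : ℕ) :
    cfQ a (n + M) * a - cfP a (n + M) =
      -(cfQ a M * a - cfP a M) * (cfQ a n * a - cfP a n) := by
  induction n with
  | zero => simp [cfQ, cfP]
  | succ n ih =>
    have hz : cfZeta a (n + M + 1) = cfZeta a (n + 1) := by
      apply cfZeta_eq_of_cfA_eq ha
      intro l
      rw [← hM (n + 1 + l) (by omega)]
      congr 1
      omega
    have h1 := cfQ_mul_sub_cfP_succ ha (n + M)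
    have h2 := cfQ_mul_sub_cfP_succ ha n
    rw [hz] at h1
    have h0 := (zero_lt_one.trans (one_lt_cfZeta_succ ha n)).ne'
    rw [add_right_comm n 1 M]
    apply mul_right_cancel₀ h0
    linear_combination h1 - ih + (cfQ a M * a - cfP a M) * h2

theorem Irrational.eq_and_eq_of_mul_sub_eq {a : ℝ} (ha : Irrational a) {x y x' y' : ℚ}
    (h : (x : ℝ) * a - y = x' * a - y') : x = x' ∧ y = y' := by
  have hx : x = x' := by
    by_contra hne
    have hne' : (x : ℝ) - x' ≠ 0 := sub_ne_zero.mpr (by exact_mod_cast hne)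
    refine ha ⟨(y - y') / (x - x'), ?_⟩
    push_cast
    rw [div_eq_iff hne']
    linarith
  subst hx
  exact ⟨rfl, by exact_mod_cast (sub_right_inj.mp h)⟩

/-- Translating the index by a period acts on the convergents of `√d` as multiplication by an
element of `ℚ(√d)`. -/
theorem cfQ_cfP_add_period {d : ℚ} (hd : 0 < d) (ha : Irrational (Real.sqrt d)) {M : ℕ}
    (hM : ∀ k, 1 ≤ k → cfA (Real.sqrt d) (k + M) = cfA (Real.sqrt d) k) (n : ℕ) :
    (cfQ (Real.sqrt d) (n + M) : ℚ) =
        cfP (Real.sqrt d) M * cfQ (Real.sqrt d) n + cfQ (Real.sqrt d) M * cfP (Real.sqrt d) n ∧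
      (cfP (Real.sqrt d) (n + M) : ℚ) =
        cfP (Real.sqrt d) M * cfP (Real.sqrt d) n +
          d * (cfQ (Real.sqrt d) M * cfQ (Real.sqrt d) n) := by
  apply ha.eq_and_eq_of_mul_sub_eq
  have h := cfQ_mul_sub_cfP_add_period ha hM n
  have hs : Real.sqrt d ^ 2 = d := Real.sq_sqrt (by exact_mod_cast hd.le)
  push_cast
  linear_combination h - cfQ (Real.sqrt d) M * cfQ (Real.sqrt d) n * hs

theorem cfP_mul_cfQ_sub (a : ℝ) (n : ℕ) :
    cfP a (n + 1) * cfQ a n - cfP a n * cfQ a (n + 1) = (-1) ^ (n + 1) := by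
  induction n with
  | zero => simp [cfP, cfQ]
  | succ n ih =>
    simp only [cfP, cfQ]
    rw [pow_succ, ← ih]
    ring

theorem q_in_terms_of_p (d : ℚ) (hd : 0 < d) (hnsq : ¬ ∃ c : ℚ, c ^ 2 = d)
    (m : ℕ) (hm : IsMinPeriod (Real.sqrt d) m) :
    ∃ v w : Fin m → ℚ, ∀ i : Fin m, ∀ k : ℕ, 1 ≤ k →
      (cfQ (Real.sqrt d) (k * m + i + 1) : ℚ) =
        v i * (cfP (Real.sqrt d) (k * m + i + 2) : ℚ) +
          w i * (cfP (Real.sqrt d) (k * m + i + 1) : ℚ) := by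
  have ha := irrational_sqrt_ratCast_of_not_sq hd hnsq
  have hper : ∀ k n, 1 ≤ n → cfA (Real.sqrt d) (n + k * m) = cfA (Real.sqrt d) n := by
    intro k n hn
    induction k with
    | zero => simp
    | succ k ih => rw [add_one_mul, ← add_assoc, hm.2.1 _ (by omega), ih]
  have add_law := fun k n => cfQ_cfP_add_period hd ha (hper k) n
  have hdet := cfP_mul_cfQ_sub (Real.sqrt d)
  generalize cfP (Real.sqrt d) = P at *
  generalize cfQ (Real.sqrt d) = Q at *
  refine ⟨fun i => (-1) ^ (i + 2 : ℕ) * (Q (i + 1) ^ 2 - P (i + 1) ^ 2 / d),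
    fun i => (-1) ^ (i + 2 : ℕ) * (P (i + 2) * P (i + 1) / d - Q (i + 2) * Q (i + 1)), ?_⟩
  intro i k _
  have h1 := add_law k (i + 1)
  have h2 := add_law k (i + 2)
  rw [show k * m + (i : ℕ) + 1 = i + 1 + k * m by ring,
    show k * m + (i : ℕ) + 2 = i + 2 + k * m by ring, h1.1, h1.2, h2.2]
  have hD : (P (i + 2) * Q (i + 1) - P (i + 1) * Q (i + 2) : ℚ) = (-1) ^ (i + 2 : ℕ) := by
    exact_mod_cast hdet (i + 1)
  have hsq : ((-1 : ℚ) ^ (i + 2 : ℕ)) ^ 2 = 1 := by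
    rw [← pow_mul, mul_comm, pow_mul]
    norm_num
  rw [← hD] at hsq
  simp only [← hD]
  field_simp
  linear_combination
    -d * (P (k * m) * Q (i + 1) + Q (k * m) * P (i + 1)) * hsq
end

section
/- Let d be a positive rational with 1.5 < √d < 2 and √d irrational, and let qₖ denote the denominators of the convergents of the continued fraction expansion of √d. Let n ∈ ℕ with n > 1 and j ∈ {0,…,n−1}. Then the set V_{j,n} = { q_l·√d : l ∈ ℕ, l > 0, l ≡ j (mod n) } ⊆ ℝ is first-order definable without parameters in the structure R_√d = (ℝ; <, +, ℤ, ℤ√d). -/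
open Real

open FirstOrder

namespace SqrtCF

section ContinuedFraction

variable {a : ℝ}

/-- The denominator `qₖ` of the `k`-th convergent. -/
noncomputable abbrev den (a : ℝ) (k : ℕ) : ℤ := cfQ a (k + 1)

lemma irrational_cfZeta (ha : Irrational a) (k : ℕ) : Irrational (cfZeta a k) := by
  induction k with
  | zero => exact ha
  | succ k ih => exact (ih.sub_intCast _).inv

lemma cfZeta_sub_floor_pos (ha : Irrational a) (k : ℕ) :
    0 < cfZeta a k - cfA a k := by
  have h := Int.floor_le (cfZeta a k)
  have h' := (irrational_cfZeta ha k).ne_int ⌊cfZeta a k⌋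
  exact sub_pos.2 (lt_of_le_of_ne h (Ne.symm h'))

lemma one_lt_cfZeta_succ (ha : Irrational a) (k : ℕ) : 1 < cfZeta a (k + 1) := by
  have h := cfZeta_sub_floor_pos ha k
  have h' := Int.lt_floor_add_one (cfZeta a k)
  exact (one_lt_inv₀ h).2 (by unfold cfA; linarith)

lemma one_le_cfA_succ (ha : Irrational a) (k : ℕ) : 1 ≤ cfA a (k + 1) :=
  Int.le_floor.2 (by exact_mod_cast (one_lt_cfZeta_succ ha k).le)

lemma den_pos (ha : Irrational a) (k : ℕ) : 0 < den a k ∧ 0 ≤ cfQ a k := by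
  induction k with
  | zero => simp [den, cfQ]
  | succ k ih =>
    refine ⟨?_, ih.1.le⟩
    have h := one_le_cfA_succ ha k
    simp only [den, cfQ] at ih ⊢
    nlinarith

lemma cfQ_add_le (ha : Irrational a) (k : ℕ) : cfQ a (k + 1) + cfQ a k ≤ cfQ a (k + 2) := by
  have h := one_le_cfA_succ ha k
  have h' := (den_pos ha k).1
  simp only [den, cfQ] at h' ⊢
  nlinarith

lemma den_mono (ha : Irrational a) : Monotone (den a) :=
  monotone_nat_of_le_succ fun k => by
    have := cfQ_add_le ha k
    have := (den_pos ha k).2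
    simp only [den]
    linarith

lemma den_lt_succ (ha : Irrational a) {k : ℕ} (hk : 1 ≤ k) : den a k < den a (k + 1) := by
  obtain ⟨k, rfl⟩ := Nat.exists_eq_add_of_le' hk
  have := cfQ_add_le ha (k + 1)
  have := (den_pos ha k).1
  simp only [den] at *
  linarith

lemma den_strictMono (ha : Irrational a) : StrictMono fun k => den a (k + 1) :=
  strictMono_nat_of_lt_succ fun k => den_lt_succ ha (Nat.succ_pos k)

lemma den_lt_den_iff (ha : Irrational a) {k l : ℕ} (hk : 1 ≤ k) (hl : 1 ≤ l) :
    den a k < den a l ↔ k < l := by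
  obtain ⟨k, rfl⟩ := Nat.exists_eq_add_of_le' hk
  obtain ⟨l, rfl⟩ := Nat.exists_eq_add_of_le' hl
  simpa using (den_strictMono ha).lt_iff_lt (a := k) (b := l)

lemma den_inj (ha : Irrational a) {k l : ℕ} (hk : 1 ≤ k) (hl : 1 ≤ l)
    (h : den a k = den a l) : k = l := by
  have h1 := den_lt_den_iff ha hk hl
  have h2 := den_lt_den_iff ha hl hk
  rw [h] at h1 h2
  simp only [lt_self_iff_false, false_iff, not_lt] at h1 h2
  omega

lemma exists_den_le_lt (ha : Irrational a) (h1 : den a 1 = 1) {N : ℤ} (hN : 0 < N) :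
    ∃ l, 1 ≤ l ∧ den a l ≤ N ∧ N < den a (l + 1) := by
  have hgrow : ∀ k : ℕ, (k : ℤ) < den a (k + 1) := fun k => by
    induction k with
    | zero => simp [h1]
    | succ k ih =>
      have := den_lt_succ ha (Nat.le_add_left 1 k)
      push_cast at *
      omega
  have hex : ∃ k : ℕ, N < den a (k + 1) := ⟨N.toNat, by have := hgrow N.toNat; omega⟩
  classical
  have hspec := Nat.find_spec hex
  have hpos : Nat.find hex ≠ 0 := by
    intro h0
    rw [h0] at hspec
    simp only [zero_add] at hspec
    omega
  refine ⟨Nat.find hex, by omega, ?_, hspec⟩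
  have := Nat.find_min hex (m := Nat.find hex - 1) (by omega)
  rw [Nat.sub_add_cancel (by omega)] at this
  omega

/-- `|βₖ|`, written with the sign `(-1)ᵏ` of `βₖ`. -/
noncomputable def absBeta (a : ℝ) (k : ℕ) : ℝ := (-1) ^ k * cfBeta a k

lemma cfBeta_rec (k : ℕ) : cfBeta a (k + 2) = cfA a (k + 2) * cfBeta a (k + 1) + cfBeta a k := by
  simp only [cfBeta, cfQ, cfP]
  push_cast
  ring

lemma absBeta_rec (k : ℕ) :
    absBeta a k = cfA a (k + 2) * absBeta a (k + 1) + absBeta a (k + 2) := by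
  simp only [absBeta, cfBeta_rec, pow_succ]
  ring

lemma cfBeta_eq (ha : Irrational a) (k : ℕ) :
    cfBeta a (k + 1) = -(cfZeta a (k + 1) - cfA a (k + 1)) * cfBeta a k := by
  induction k with
  | zero =>
    have h := cfZeta_sub_floor_pos ha 0
    have hz : cfZeta a 1 * (a - cfA a 0) = 1 := by
      simp only [cfZeta]
      exact inv_mul_cancel₀ h.ne'
    simp only [cfBeta, cfQ, cfP]
    push_cast
    linear_combination hz
  | succ k ih =>
    have h := cfZeta_sub_floor_pos ha (k + 1)
    have hz : cfZeta a (k + 2) * (cfZeta a (k + 1) - cfA a (k + 1)) = 1 :=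
      inv_mul_cancel₀ h.ne'
    rw [cfBeta_rec]
    rw [show k + 1 + 1 = k + 2 from rfl]
    linear_combination (cfZeta a (k + 2)) * ih - cfBeta a k * hz

lemma absBeta_pos (ha : Irrational a) (k : ℕ) : 0 < absBeta a k := by
  induction k with
  | zero =>
    have := cfZeta_sub_floor_pos ha 0
    simpa [absBeta, cfBeta, cfQ, cfP, cfZeta] using this
  | succ k ih =>
    have h := mul_pos (cfZeta_sub_floor_pos ha (k + 1)) ih
    have : absBeta a (k + 1) = (cfZeta a (k + 1) - cfA a (k + 1)) * absBeta a k := by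
      simp only [absBeta, cfBeta_eq ha k, pow_succ]
      ring
    rwa [this]

lemma absBeta_add_le (ha : Irrational a) (k : ℕ) :
    absBeta a (k + 1) + absBeta a (k + 2) ≤ absBeta a k := by
  have h : (1 : ℝ) ≤ cfA a (k + 2) := by exact_mod_cast one_le_cfA_succ ha (k + 1)
  rw [absBeta_rec (a := a) k]
  nlinarith [absBeta_pos ha (k + 1)]

lemma absBeta_succ_lt (ha : Irrational a) (k : ℕ) : absBeta a (k + 1) < absBeta a k := by
  linarith [absBeta_add_le ha k, absBeta_pos ha (k + 2)]

lemma abs_cfBeta (ha : Irrational a) (k : ℕ) : |cfBeta a k| = absBeta a k := by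
  rw [← abs_of_pos (absBeta_pos ha k), absBeta, abs_mul, abs_pow, abs_neg, abs_one, one_pow,
    one_mul]

lemma cf_det (k : ℕ) : cfQ a (k + 1) * cfP a k - cfQ a k * cfP a (k + 1) = (-1) ^ k := by
  induction k with
  | zero => simp [cfQ, cfP]
  | succ k ih =>
    simp only [cfQ, cfP]
    rw [pow_succ, ← ih]
    ring

/-- The law of best approximation. -/
lemma absBeta_le (ha : Irrational a) (k : ℕ) {N : ℤ} (p : ℤ) (hN : N ≠ 0)
    (hlt : |N| < den a (k + 1)) : absBeta a k ≤ |N * a - p| := by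
  obtain ⟨s, hs1, hs⟩ : ∃ s : ℤ, s * s = 1 ∧
      cfQ a (k + 2) * cfP a (k + 1) - cfQ a (k + 1) * cfP a (k + 2) = s :=
    ⟨(-1) ^ (k + 1), by rw [← mul_pow]; simp, cf_det (k + 1)⟩
  obtain ⟨u, hu⟩ : ∃ u, u = s * (p * cfQ a (k + 2) - N * cfP a (k + 2)) := ⟨_, rfl⟩
  obtain ⟨v, hv⟩ : ∃ v, v = s * (N * cfP a (k + 1) - p * cfQ a (k + 1)) := ⟨_, rfl⟩
  have hNuv : N = u * cfQ a (k + 1) + v * cfQ a (k + 2) := by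
    subst hu hv
    linear_combination (-N) * hs1 - N * s * hs
  have hpuv : p = u * cfP a (k + 1) + v * cfP a (k + 2) := by
    subst hu hv
    linear_combination (-p) * hs1 - p * s * hs
  have hval : (N : ℝ) * a - p = u * cfBeta a k + v * cfBeta a (k + 1) := by
    rw [hNuv, hpuv]
    simp only [cfBeta]
    push_cast
    ring
  have hsign : |(N : ℝ) * a - p| = |u * absBeta a k - v * absBeta a (k + 1)| := by
    rw [hval, ← one_mul |(u : ℝ) * _ + _|, ← abs_one (α := ℝ), ← one_pow k,
      show |(1 : ℝ) ^ k| = |(-1) ^ k| by simp, ← abs_mul]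
    congr 1
    simp only [absBeta, pow_succ]
    ring
  have hq := (den_pos ha k).1
  have hq' := (den_pos ha (k + 1)).1
  have hb := absBeta_pos ha k
  have hb' := absBeta_pos ha (k + 1)
  simp only [den] at hq hq' hlt
  rw [show k + 1 + 1 = k + 2 from rfl] at hq' hlt
  rw [abs_lt] at hlt
  rw [hsign, le_abs]
  rcases lt_trichotomy v 0 with h | h | h
  · have hu1 : 1 ≤ u := by
      by_contra hcon
      nlinarith
    have h1 : (1 : ℝ) ≤ u := by exact_mod_cast hu1
    have h2 : (v : ℝ) ≤ 0 := by exact_mod_cast h.le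
    left
    nlinarith
  · rw [h, zero_mul, add_zero] at hNuv
    rw [h]
    rcases lt_trichotomy u 0 with h' | h' | h'
    · have h1 : (u : ℝ) ≤ -1 := by exact_mod_cast (show u ≤ -1 by omega)
      right
      push_cast
      nlinarith
    · simp [h'] at hNuv
      exact absurd hNuv hN
    · have h1 : (1 : ℝ) ≤ u := by exact_mod_cast h'
      left
      push_cast
      nlinarith
  · have hu1 : u ≤ -1 := by
      by_contra hcon
      nlinarith
    have h1 : (u : ℝ) ≤ -1 := by exact_mod_cast hu1
    have h2 : (0 : ℝ) ≤ v := by exact_mod_cast h.le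
    right
    nlinarith

end ContinuedFraction

section Coding

variable {a : ℝ}

open Classical in
/-- `∑ qᵢ` over the `i < k` with `F i`. -/
noncomputable def denSum (a : ℝ) (F : ℕ → Prop) (k : ℕ) : ℤ :=
  ∑ i ∈ Finset.range k, if F i then den a i else 0

open Classical in
/-- `∑ pᵢ` over the `i < k` with `F i`. -/
noncomputable def numSum (a : ℝ) (F : ℕ → Prop) (k : ℕ) : ℤ :=
  ∑ i ∈ Finset.range k, if F i then cfP a (i + 1) else 0

open Classical in
/-- `∑ |βᵢ|` over the `i ∈ [k, k + r)` with `F i`. -/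
noncomputable def absBetaSum (a : ℝ) (F : ℕ → Prop) (k r : ℕ) : ℝ :=
  ∑ i ∈ Finset.range r, if F (k + i) then absBeta a (k + i) else 0

lemma absBetaSum_nonneg (ha : Irrational a) (F : ℕ → Prop) (k r : ℕ) :
    0 ≤ absBetaSum a F k r :=
  Finset.sum_nonneg fun i _ => by
    split_ifs
    exacts [(absBeta_pos ha _).le, le_rfl]

lemma absBetaSum_succ (F : ℕ → Prop) [DecidablePred F] (k r : ℕ) :
    absBetaSum a F k (r + 1) = (if F k then absBeta a k else 0) + absBetaSum a F (k + 1) r := by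
  rw [absBetaSum, Finset.sum_range_succ', add_comm, absBetaSum]
  simp only [add_zero, add_assoc, add_comm 1]
  congr!

lemma absBetaSum_lt (ha : Irrational a) {F : ℕ → Prop} (hF : ∀ i, F i → ¬ F (i + 1)) (r k : ℕ) :
    absBetaSum a F (k + 1) r < absBeta a k ∧
      (¬ F (k + 1) → absBetaSum a F (k + 1) r < absBeta a (k + 1)) := by
  classical
  induction r generalizing k with
  | zero => simp [absBetaSum, absBeta_pos ha]
  | succ r ih =>
    rw [absBetaSum_succ]
    by_cases h : F (k + 1)
    · have := (ih (k + 1)).2 (hF _ h)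
      have := absBeta_add_le ha k
      simp only [h, if_true, not_true_eq_false, false_imp_iff, and_true]
      linarith
    · have := (ih (k + 1)).1
      have := absBeta_succ_lt ha k
      simp only [h, if_false, not_false_eq_true, true_imp_iff]
      constructor <;> linarith

lemma denSum_succ (F : ℕ → Prop) [DecidablePred F] (k : ℕ) :
    denSum a F (k + 1) = denSum a F k + if F k then den a k else 0 := by
  rw [denSum, Finset.sum_range_succ, denSum]
  congr

lemma denSum_lt (ha : Irrational a) (h1 : den a 1 = 1) {F : ℕ → Prop} (hF0 : ¬ F 0)
    (hF : ∀ i, F i → ¬ F (i + 1)) (k : ℕ) :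
    denSum a F (k + 1) < den a (k + 1) ∧ (¬ F k → denSum a F (k + 1) < den a k) := by
  classical
  induction k with
  | zero => simp [denSum, hF0, h1, (den_pos ha 0).1]
  | succ k ih =>
    rw [denSum_succ]
    by_cases h : F (k + 1)
    · have := ih.2 fun hk => hF _ hk h
      have := cfQ_add_le ha (k + 1)
      simp only [h, if_true, not_true_eq_false, false_imp_iff, and_true]
      simp only [den] at *
      linarith
    · have := ih.1
      have := den_mono ha (Nat.le_succ (k + 1))
      simp only [h, if_false, not_false_eq_true, true_imp_iff]
      simp only [den] at *
      constructor <;> linarith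

lemma denSum_nonneg (ha : Irrational a) (F : ℕ → Prop) (k : ℕ) : 0 ≤ denSum a F k :=
  Finset.sum_nonneg fun i _ => by
    split_ifs
    exacts [(den_pos ha _).1.le, le_rfl]

lemma denSum_add {F : ℕ → Prop} (hF : ∀ i, F i → Even i) (k r : ℕ) :
    (denSum a F (k + r) : ℝ) * a - numSum a F (k + r) =
      denSum a F k * a - numSum a F k + absBetaSum a F k r := by
  classical
  simp only [denSum, numSum, absBetaSum, Finset.sum_range_add]
  push_cast
  have : ∀ i, (if F (k + i) then absBeta a (k + i) else 0) =
      (if F (k + i) then (den a (k + i) : ℝ) else 0) * a -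
        if F (k + i) then (cfP a (k + i + 1) : ℝ) else 0 := fun i => by
    split_ifs with h
    · rw [absBeta, (hF _ h).neg_one_pow, one_mul, cfBeta]
    · simp
  simp only [this, Finset.sum_sub_distrib, ← Finset.sum_mul]
  ring

/-- For consecutive denominators `x = qₖ a`, `y = qₖ₊₁ a`, the real `t` is approximated from below
modulo `ℤ`, up to an error less than the distance of `x` to `ℤ`, by some `N a` with
`qₖ ≤ N < qₖ₊₁`. -/
def Hits (a x y t : ℝ) : Prop :=
  ∃ z, (∃ N : ℤ, z = N * a) ∧ ∃ p : ℝ, (∃ m : ℤ, p = m) ∧ ¬ z < x ∧ z < y ∧ ¬ t < z + p ∧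
    ∀ p' : ℝ, (∃ m : ℤ, p' = m) → t + p' < x + z + p ∨ t + x < z + p + p'

/-- Every set of even positive numbers is coded, on an initial segment, by a real. -/
lemma exists_code (ha : Irrational a) (ha0 : 0 < a) (h1 : den a 1 = 1) {F : ℕ → Prop}
    (hF0 : ¬ F 0) (hF : ∀ i, F i → Even i) (L : ℕ) :
    ∃ t, ∀ k, 1 ≤ k → k ≤ L → (Hits a (den a k * a) (den a (k + 1) * a) t ↔ F k) := by
  classical
  have hF' : ∀ i, F i → ¬ F (i + 1) := fun i hi hi' => by
    have := hF _ hi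
    have := hF _ hi'
    grind
  refine ⟨denSum a F (L + 1) * a - numSum a F (L + 1), fun k hk hkL => ?_⟩
  obtain ⟨r, hr⟩ := Nat.exists_eq_add_of_le (Nat.add_le_add_right hkL 1)
  have ht := denSum_add (a := a) hF (k + 1) r
  rw [hr, ht]
  have hlt := (absBetaSum_lt ha hF' r k).1
  have h0 := absBetaSum_nonneg ha F (k + 1) r
  set τ := absBetaSum a F (k + 1) r
  have hN := (denSum_lt ha h1 hF0 hF' k).1
  have hN0 := denSum_nonneg ha F (k + 1)
  have hqk := den_lt_succ ha hk
  have hqpos := (den_pos ha k).1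
  have hiff : den a k ≤ denSum a F (k + 1) ↔ F k := by
    obtain ⟨k, rfl⟩ := Nat.exists_eq_add_of_le' hk
    have := (denSum_lt ha h1 hF0 hF' k).1
    have := denSum_nonneg ha F (k + 1)
    rw [denSum_succ]
    split_ifs with h
    · simp only [h, iff_true]; omega
    · simp only [h, iff_false]; omega
  rw [← hiff]
  constructor
  · rintro ⟨_, ⟨N, rfl⟩, _, ⟨m, rfl⟩, hz1, hz2, hz3, hz4⟩
    rw [not_lt] at hz1 hz3
    have hN1 : den a k ≤ N := by exact_mod_cast le_of_mul_le_mul_right hz1 ha0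
    have hN2 : N < den a (k + 1) := by exact_mod_cast lt_of_mul_lt_mul_right hz2 ha0.le
    have hdist : denSum a F (k + 1) * a - numSum a F (k + 1) + τ - N * a - m < absBeta a k := by
      rw [← abs_cfBeta ha k, lt_abs, cfBeta]
      rcases hz4 _ ⟨cfP a (k + 1), rfl⟩ with h | h
      · left; linarith
      · right; linarith
    suffices h : N = denSum a F (k + 1) by rwa [← h]
    by_contra hne
    have := absBeta_le ha k (N := denSum a F (k + 1) - N) (numSum a F (k + 1) + m)
      (sub_ne_zero.2 (Ne.symm hne)) (by rw [abs_lt]; constructor <;> omega)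
    push_cast at this
    rw [le_abs] at this
    rcases this with h | h <;> linarith
  · intro h
    refine ⟨_, ⟨denSum a F (k + 1), rfl⟩, _, ⟨-numSum a F (k + 1), rfl⟩, ?_, ?_, ?_, ?_⟩
    · rw [not_lt]
      exact mul_le_mul_of_nonneg_right (by exact_mod_cast h) ha0.le
    · exact mul_lt_mul_of_pos_right (by exact_mod_cast hN) ha0
    · push_cast; linarith
    · rintro _ ⟨m, rfl⟩
      have := absBeta_le ha k (N := den a k) m hqpos.ne' (by rwa [abs_of_pos hqpos])
      rw [le_abs] at this
      push_cast
      rcases this with h | h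
      · left; linarith
      · right; linarith

end Coding

section Predicates

variable {a : ℝ}

/-- `x` is a positive element of `ℤ a` that is closer to `ℤ` than all smaller ones. -/
def IsBest (a x : ℝ) : Prop :=
  (∃ N : ℤ, x = N * a) ∧ x < x + x ∧ ∃ p : ℝ, (∃ m : ℤ, p = m) ∧
    ∀ y, (∃ N : ℤ, y = N * a) → y < y + y → y < x → ∀ p' : ℝ, (∃ m : ℤ, p' = m) →
      ((x + p' < y + p ∧ p + p' < y + x) ∨ (x + y < p + p' ∧ p + y < x + p'))

/-- `x < y` are consecutive best approximations. -/
def IsNext (a x y : ℝ) : Prop :=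
  IsBest a x ∧ IsBest a y ∧ x < y ∧ ∀ z, IsBest a z → x < z → ¬ z < y

/-- `y` is the `r`-th best approximation after `x`. -/
def IsNextIter (a : ℝ) : ℕ → ℝ → ℝ → Prop
  | 0, x, y => IsBest a x ∧ x = y
  | r + 1, x, y => ∃ z, IsNextIter a r x z ∧ IsNext a z y

/-- The best approximation `x` belongs to the set coded by `t`. -/
def InCode (a x t : ℝ) : Prop := ∃ y, IsNext a x y ∧ Hits a x y t

/-- `x` is `q_l a` for a positive multiple `l` of `M`, as witnessed by a code of the set of these
elements up to `x`. -/
def IsMultiple (a : ℝ) (M : ℕ) (x : ℝ) : Prop :=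
  ∃ t, InCode a x t ∧ ∀ y, IsBest a y → ¬ x < y →
    (InCode a y t ↔ (((∃ w, IsNextIter a (M - 1) w y) ∧ ¬ ∃ z, IsNextIter a M z y) ∨
      ∃ z, InCode a z t ∧ IsNextIter a M z y))

lemma abs_sub_lt_abs_sub {x p y p' : ℝ} : |x - p| < |y - p'| ↔
    (x + p' < y + p ∧ p + p' < y + x) ∨ (x + y < p + p' ∧ p + y < x + p') := by
  rw [lt_abs, abs_lt, abs_lt]
  constructor
  · rintro (h | h)
    · left; constructor <;> linarith
    · right; constructor <;> linarith
  · rintro (h | h)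
    · left; constructor <;> linarith
    · right; constructor <;> linarith

lemma isBest_iff (ha : Irrational a) (ha0 : 0 < a) (h1 : den a 1 = 1) {x : ℝ} :
    IsBest a x ↔ ∃ l, 1 ≤ l ∧ x = den a l * a := by
  simp only [IsBest, ← abs_sub_lt_abs_sub]
  constructor
  · rintro ⟨⟨N, rfl⟩, hpos, _, ⟨m, rfl⟩, h⟩
    have hN : 0 < N := by
      have : (0 : ℝ) < N := pos_of_mul_pos_left (b := a) (by linarith) ha0.le
      exact_mod_cast this
    obtain ⟨l, hl, hle, hlt⟩ := exists_den_le_lt ha h1 hN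
    refine ⟨l, hl, ?_⟩
    by_contra hne
    have hlt' : den a l < N := lt_of_le_of_ne hle fun h => hne (by rw [h])
    have hlpos : (0 : ℝ) < den a l := by exact_mod_cast (den_pos ha l).1
    have := h _ ⟨den a l, rfl⟩ (by nlinarith)
      (mul_lt_mul_of_pos_right (by exact_mod_cast hlt') ha0) _ ⟨cfP a (l + 1), rfl⟩
    have h' := absBeta_le ha l m hN.ne' (by rwa [abs_of_pos hN])
    rw [← abs_cfBeta ha, cfBeta] at h'
    exact absurd this (not_lt.2 h')
  · rintro ⟨l, hl, rfl⟩
    have hlpos : (0 : ℝ) < den a l := by exact_mod_cast (den_pos ha l).1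
    refine ⟨⟨_, rfl⟩, by nlinarith, _, ⟨cfP a (l + 1), rfl⟩, ?_⟩
    rintro _ ⟨N, rfl⟩ hpos hlt _ ⟨m, rfl⟩
    have hN : 0 < N := by
      have : (0 : ℝ) < N := pos_of_mul_pos_left (b := a) (by linarith) ha0.le
      exact_mod_cast this
    have hN2 : N < den a l := by exact_mod_cast lt_of_mul_lt_mul_right hlt ha0.le
    obtain ⟨l, rfl⟩ := Nat.exists_eq_add_of_le' hl
    have h := absBeta_le ha l m hN.ne' (by rwa [abs_of_pos hN])
    have h' := absBeta_succ_lt ha l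
    rw [← abs_cfBeta ha (l + 1), cfBeta] at h'
    exact h'.trans_le h

lemma den_mul_lt_iff (ha : Irrational a) (ha0 : 0 < a) {k l : ℕ} (hk : 1 ≤ k) (hl : 1 ≤ l) :
    (den a k * a < den a l * a) ↔ k < l := by
  rw [← den_lt_den_iff ha hk hl, mul_lt_mul_iff_left₀ ha0, Int.cast_lt]

lemma den_mul_inj (ha : Irrational a) (ha0 : 0 < a) {k l : ℕ} (hk : 1 ≤ k) (hl : 1 ≤ l)
    (h : (den a k * a : ℝ) = den a l * a) : k = l :=
  den_inj ha hk hl (by exact_mod_cast mul_right_cancel₀ ha0.ne' h)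

lemma isNext_iff (ha : Irrational a) (ha0 : 0 < a) (h1 : den a 1 = 1) {x y : ℝ} :
    IsNext a x y ↔ ∃ l, 1 ≤ l ∧ x = den a l * a ∧ y = den a (l + 1) * a := by
  simp only [IsNext, isBest_iff ha ha0 h1]
  constructor
  · rintro ⟨⟨l, hl, rfl⟩, ⟨k, hk, rfl⟩, hlt, h⟩
    rw [den_mul_lt_iff ha ha0 hl hk] at hlt
    have := h _ ⟨l + 1, by omega, rfl⟩ ((den_mul_lt_iff ha ha0 hl (by omega)).2 (by omega))
    rw [den_mul_lt_iff ha ha0 (by omega) hk] at this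
    obtain rfl : k = l + 1 := by omega
    exact ⟨l, hl, rfl, rfl⟩
  · rintro ⟨l, hl, rfl, rfl⟩
    refine ⟨⟨l, hl, rfl⟩, ⟨l + 1, by omega, rfl⟩,
      (den_mul_lt_iff ha ha0 hl (by omega)).2 (by omega), ?_⟩
    rintro _ ⟨k, hk, rfl⟩ hlt
    rw [den_mul_lt_iff ha ha0 hl hk] at hlt
    rw [den_mul_lt_iff ha ha0 hk (by omega)]
    omega

lemma isNextIter_iff (ha : Irrational a) (ha0 : 0 < a) (h1 : den a 1 = 1) {r : ℕ} {x y : ℝ} :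
    IsNextIter a r x y ↔ ∃ l, 1 ≤ l ∧ x = den a l * a ∧ y = den a (l + r) * a := by
  induction r generalizing y with
  | zero =>
    simp only [IsNextIter, isBest_iff ha ha0 h1, add_zero]
    constructor
    · rintro ⟨⟨l, hl, rfl⟩, rfl⟩
      exact ⟨l, hl, rfl, rfl⟩
    · rintro ⟨l, hl, rfl, rfl⟩
      exact ⟨⟨l, hl, rfl⟩, rfl⟩
  | succ r ih =>
    simp only [IsNextIter, ih, isNext_iff ha ha0 h1]
    constructor
    · rintro ⟨_, ⟨l, hl, rfl, rfl⟩, k, hk, hlk, rfl⟩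
      obtain rfl := den_mul_inj ha ha0 (by omega) hk hlk
      exact ⟨l, hl, rfl, rfl⟩
    · rintro ⟨l, hl, rfl, rfl⟩
      exact ⟨_, ⟨l, hl, rfl, rfl⟩, l + r, by omega, rfl, rfl⟩

lemma inCode_iff (ha : Irrational a) (ha0 : 0 < a) (h1 : den a 1 = 1) {k : ℕ} (hk : 1 ≤ k)
    {t : ℝ} : InCode a (den a k * a) t ↔ Hits a (den a k * a) (den a (k + 1) * a) t := by
  simp only [InCode, isNext_iff ha ha0 h1]
  constructor
  · rintro ⟨_, ⟨l, hl, hkl, rfl⟩, h⟩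
    obtain rfl := den_mul_inj ha ha0 hk hl hkl
    exact h
  · intro h
    exact ⟨_, ⟨k, hk, rfl, rfl⟩, h⟩

lemma exists_isNextIter_iff (ha : Irrational a) (ha0 : 0 < a) (h1 : den a 1 = 1) {r l : ℕ}
    (hl : 1 ≤ l) (P : ℝ → Prop) :
    (∃ z, P z ∧ IsNextIter a r z (den a l * a)) ↔ r < l ∧ P (den a (l - r) * a) := by
  simp only [isNextIter_iff ha ha0 h1]
  constructor
  · rintro ⟨_, hP, k, hk, rfl, hkl⟩
    obtain rfl := den_mul_inj ha ha0 hl (by omega) hkl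
    refine ⟨by omega, ?_⟩
    rwa [Nat.add_sub_cancel]
  · rintro ⟨hlt, hP⟩
    refine ⟨_, hP, l - r, by omega, rfl, ?_⟩
    rw [Nat.sub_add_cancel hlt.le]

lemma isMultiple_iff (ha : Irrational a) (ha0 : 0 < a) (h1 : den a 1 = 1) {M : ℕ} (hM : 0 < M)
    (hM2 : Even M) {x : ℝ} :
    IsMultiple a M x ↔ ∃ l, 1 ≤ l ∧ M ∣ l ∧ x = den a l * a := by
  have hrec : ∀ (l : ℕ) (C : ℝ → Prop), 1 ≤ l →
      ((((∃ w, IsNextIter a (M - 1) w (den a l * a)) ∧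
          ¬ ∃ z, IsNextIter a M z (den a l * a)) ∨
        ∃ z, C z ∧ IsNextIter a M z (den a l * a)) ↔
      (l = M ∨ (M < l ∧ C (den a (l - M) * a)))) := fun l C hl => by
    have hw := exists_isNextIter_iff ha ha0 h1 (r := M - 1) hl fun _ => True
    have hz := exists_isNextIter_iff ha ha0 h1 (r := M) hl fun _ => True
    simp only [true_and, and_true] at hw hz
    rw [hw, hz, exists_isNextIter_iff ha ha0 h1 hl C]
    refine or_congr ?_ Iff.rfl
    omega
  have hdvd : ∀ l, 1 ≤ l → (M ∣ l ↔ l = M ∨ (M < l ∧ M ∣ l - M)) := fun l hl => by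
    rcases lt_trichotomy l M with h | rfl | h
    · have := Nat.not_dvd_of_pos_of_lt hl h
      simp only [this, false_iff]
      omega
    · simp
    · rw [Nat.dvd_sub_self_right, or_iff_right h.ne', and_iff_right h, or_iff_left h.not_ge]
  constructor
  · rintro ⟨t, ht, h⟩
    obtain ⟨y, hy, -⟩ := id ht
    obtain ⟨l, hl, rfl, -⟩ := (isNext_iff ha ha0 h1).1 hy
    have key : ∀ k, 1 ≤ k → k ≤ l → (InCode a (den a k * a) t ↔ M ∣ k) := fun k => by
      induction k using Nat.strong_induction_on with
      | _ k ih =>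
        intro hk hkl
        rw [h _ ((isBest_iff ha ha0 h1).2 ⟨k, hk, rfl⟩)
          (by rw [den_mul_lt_iff ha ha0 hl hk]; omega),
          hrec k (fun z => InCode a z t) hk, hdvd k hk]
        refine or_congr Iff.rfl (and_congr_right fun hlt => ?_)
        exact ih (k - M) (by omega) (by omega) (by omega)
    exact ⟨l, hl, (key l hl le_rfl).1 ht, rfl⟩
  · rintro ⟨l, hl, hMl, rfl⟩
    obtain ⟨t, ht⟩ := exists_code ha ha0 h1 (F := fun i => 0 < i ∧ M ∣ i) (by simp)
      (fun i hi => (even_iff_two_dvd.1 hM2).trans hi.2 |> even_iff_two_dvd.2) l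
    have key : ∀ k, 1 ≤ k → k ≤ l → (InCode a (den a k * a) t ↔ M ∣ k) := fun k hk hkl => by
      rw [inCode_iff ha ha0 h1 hk, ht k hk hkl]
      exact and_iff_right hk
    refine ⟨t, (key l hl le_rfl).2 hMl, fun y hy hle => ?_⟩
    obtain ⟨k, hk, rfl⟩ := (isBest_iff ha ha0 h1).1 hy
    rw [den_mul_lt_iff ha ha0 hl hk, not_lt] at hle
    rw [hrec k (fun z => InCode a z t) hk, key k hk hle, hdvd k hk]
    refine or_congr Iff.rfl (and_congr_right fun hlt => ?_)
    exact (key (k - M) (by omega) (by omega)).symm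

lemma exists_mod_eq_iff (ha : Irrational a) (ha0 : 0 < a) (h1 : den a 1 = 1) {n j : ℕ}
    (hj : j < n) {x : ℝ} :
    (∃ l : ℕ, 0 < l ∧ l % n = j ∧ x = den a l * a) ↔
      ∃ r < 2 * n, (j + r) % n = 0 ∧ ∃ y, IsNextIter a r x y ∧ IsMultiple a (2 * n) y := by
  simp only [isMultiple_iff ha ha0 h1 (show 0 < 2 * n by omega) (even_two_mul n),
    isNextIter_iff ha ha0 h1]
  constructor
  · rintro ⟨l, hl, hlj, rfl⟩
    have hr : ∃ r < 2 * n, 2 * n ∣ l + r := by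
      rcases Nat.eq_zero_or_pos (l % (2 * n)) with h | h
      · exact ⟨0, by omega, Nat.dvd_of_mod_eq_zero h⟩
      · have hlt := Nat.mod_lt l (show 0 < 2 * n by omega)
        refine ⟨2 * n - l % (2 * n), by omega, l / (2 * n) + 1, ?_⟩
        have := Nat.div_add_mod l (2 * n)
        rw [mul_add]
        omega
    obtain ⟨r, hr, hdvd⟩ := hr
    refine ⟨r, hr, ?_, _, ⟨l, hl, rfl, rfl⟩, l + r, by omega, hdvd, rfl⟩
    rw [← hlj, Nat.mod_add_mod]
    exact Nat.mod_eq_zero_of_dvd ((Dvd.intro_left 2 rfl).trans hdvd)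
  · rintro ⟨r, -, hjr, _, ⟨l, hl, rfl, rfl⟩, k, hk, hdvd, hlk⟩
    obtain rfl := den_mul_inj ha ha0 (by omega) hk hlk
    refine ⟨l, hl, ?_, rfl⟩
    have h : (l + r) % n = 0 :=
      Nat.mod_eq_zero_of_dvd ((Dvd.intro_left 2 rfl).trans hdvd)
    have h' : l ≡ j [MOD n] := Nat.ModEq.add_right_cancel' r (h.trans hjr.symm)
    rw [h', Nat.mod_eq_of_lt hj]

end Predicates

section Definability

variable {d : ℚ} {α : Type}

/-- `f` is given by a term of the language of `R_√d`. -/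
def IsTerm (d : ℚ) (f : (α → ℝ) → ℝ) : Prop :=
  letI := rStruc d
  ∃ t : rLang.Term α, ∀ v : α → ℝ, t.realize v = f v

/-- `P` is given by a formula over `R_√d`. -/
def IsDef (d : ℚ) (P : (α → ℝ) → Prop) : Prop :=
  letI := rStruc d
  ∃ φ : rLang.Formula α, ∀ v : α → ℝ, φ.Realize v ↔ P v

lemma IsTerm.var (i : α) : IsTerm d fun v => v i :=
  let := rStruc d
  ⟨Language.var i, fun _ => rfl⟩

lemma IsTerm.lift {f : (α → ℝ) → ℝ} (hf : IsTerm d f) :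
    IsTerm d fun w : Option α → ℝ => f fun i => w (some i) := by
  let := rStruc d
  obtain ⟨t, ht⟩ := hf
  exact ⟨t.relabel some, fun w => by rw [Language.Term.realize_relabel, ht]; rfl⟩

lemma IsTerm.add {f g : (α → ℝ) → ℝ} (hf : IsTerm d f) (hg : IsTerm d g) :
    IsTerm d fun v => f v + g v := by
  let := rStruc d
  obtain ⟨s, hs⟩ := hf
  obtain ⟨t, ht⟩ := hg
  refine ⟨Language.Functions.apply₂ (L := rLang) (show rLang.Functions 2 from ()) s t,
    fun v => ?_⟩
  rw [Language.Term.realize_functions_apply₂, hs, ht]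
  rfl

lemma IsDef.lt {f g : (α → ℝ) → ℝ} (hf : IsTerm d f) (hg : IsTerm d g) :
    IsDef d fun v => f v < g v := by
  let := rStruc d
  obtain ⟨s, hs⟩ := hf
  obtain ⟨t, ht⟩ := hg
  refine ⟨Language.Relations.formula₂ (L := rLang) (show rLang.Relations 2 from ()) s t,
    fun v => ?_⟩
  rw [Language.Formula.realize_rel₂, hs, ht]
  rfl

lemma IsDef.int {f : (α → ℝ) → ℝ} (hf : IsTerm d f) : IsDef d fun v => ∃ m : ℤ, f v = m := by
  let := rStruc d
  obtain ⟨s, hs⟩ := hf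
  refine ⟨Language.Relations.formula₁ (L := rLang) (show rLang.Relations 1 from false) s,
    fun v => ?_⟩
  rw [Language.Formula.realize_rel₁, hs]
  rfl

lemma IsDef.int_mul_sqrt {f : (α → ℝ) → ℝ} (hf : IsTerm d f) :
    IsDef d fun v => ∃ m : ℤ, f v = m * √(d : ℝ) := by
  let := rStruc d
  obtain ⟨s, hs⟩ := hf
  refine ⟨Language.Relations.formula₁ (L := rLang) (show rLang.Relations 1 from true) s,
    fun v => ?_⟩
  rw [Language.Formula.realize_rel₁, hs]
  rfl

lemma IsDef.eq {f g : (α → ℝ) → ℝ} (hf : IsTerm d f) (hg : IsTerm d g) :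
    IsDef d fun v => f v = g v := by
  let := rStruc d
  obtain ⟨s, hs⟩ := hf
  obtain ⟨t, ht⟩ := hg
  exact ⟨s.equal t, fun v => by rw [Language.Formula.realize_equal, hs, ht]⟩

lemma IsDef.not {P : (α → ℝ) → Prop} (hP : IsDef d P) : IsDef d fun v => ¬ P v := by
  let := rStruc d
  obtain ⟨φ, hφ⟩ := hP
  exact ⟨φ.not, fun v => by rw [Language.Formula.realize_not, hφ]⟩

lemma IsDef.and {P Q : (α → ℝ) → Prop} (hP : IsDef d P) (hQ : IsDef d Q) :
    IsDef d fun v => P v ∧ Q v := by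
  let := rStruc d
  obtain ⟨φ, hφ⟩ := hP
  obtain ⟨ψ, hψ⟩ := hQ
  exact ⟨φ ⊓ ψ, fun v => by rw [Language.Formula.realize_inf, hφ, hψ]⟩

lemma IsDef.or {P Q : (α → ℝ) → Prop} (hP : IsDef d P) (hQ : IsDef d Q) :
    IsDef d fun v => P v ∨ Q v := by
  let := rStruc d
  obtain ⟨φ, hφ⟩ := hP
  obtain ⟨ψ, hψ⟩ := hQ
  exact ⟨φ ⊔ ψ, fun v => by rw [Language.Formula.realize_sup, hφ, hψ]⟩

lemma IsDef.imp {P Q : (α → ℝ) → Prop} (hP : IsDef d P) (hQ : IsDef d Q) :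
    IsDef d fun v => P v → Q v := by
  simpa only [imp_iff_not_or] using hP.not.or hQ

lemma IsDef.iff {P Q : (α → ℝ) → Prop} (hP : IsDef d P) (hQ : IsDef d Q) :
    IsDef d fun v => (P v ↔ Q v) := by
  simpa only [iff_iff_implies_and_implies] using (hP.imp hQ).and (hQ.imp hP)

lemma IsDef.ex {P : (α → ℝ) → ℝ → Prop}
    (hP : IsDef d fun w : Option α → ℝ => P (fun i => w (some i)) (w none)) :
    IsDef d fun v => ∃ x, P v x := by
  let := rStruc d
  obtain ⟨φ, hφ⟩ := hP
  refine ⟨Language.Formula.iExs Unit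
    (φ.relabel (fun o : Option α => o.elim (Sum.inr ()) Sum.inl)), fun v => ?_⟩
  rw [Language.Formula.realize_iExs]
  simp only [Language.Formula.realize_relabel, hφ, Function.comp_def, Option.elim, Sum.elim_inl,
    Sum.elim_inr]
  exact ⟨fun ⟨i, hi⟩ => ⟨_, hi⟩, fun ⟨x, hx⟩ => ⟨fun _ => x, hx⟩⟩

lemma IsDef.all {P : (α → ℝ) → ℝ → Prop}
    (hP : IsDef d fun w : Option α → ℝ => P (fun i => w (some i)) (w none)) :
    IsDef d fun v => ∀ x, P v x := by
  simpa only [not_exists, not_not] using (IsDef.ex (P := fun v x => ¬ P v x) hP.not).not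

lemma IsDef.exists_nat_lt {P : ℕ → (α → ℝ) → Prop} (Q : ℕ → Prop) (hP : ∀ r, IsDef d (P r))
    (m : ℕ) (i : α) : IsDef d fun v => ∃ r < m, Q r ∧ P r v := by
  induction m with
  | zero => simpa using IsDef.lt (d := d) (IsTerm.var i) (IsTerm.var i)
  | succ m ih =>
    simp only [Nat.lt_succ_iff_lt_or_eq, or_and_right, exists_or, exists_eq_left]
    by_cases h : Q m
    · simpa only [h, true_and] using ih.or (hP m)
    · simpa only [h, false_and, or_false] using ih

lemma isDef_hits {f g h : (α → ℝ) → ℝ} (hf : IsTerm d f) (hg : IsTerm d g) (hh : IsTerm d h) :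
    IsDef d fun v => Hits √(d : ℝ) (f v) (g v) (h v) := by
  unfold Hits
  exact .ex (.and (.int_mul_sqrt (.var none)) (.ex (.and (.int (.var none)) (.and (.not (.lt
    (.var (some none)) hf.lift.lift)) (.and (.lt (.var (some none)) hg.lift.lift) (.and (.not (.lt
    hh.lift.lift (.add (.var (some none)) (.var none)))) (.all (.imp (.int (.var none)) (.or (.lt
    (.add hh.lift.lift.lift (.var none)) (.add (.add hf.lift.lift.lift (.var (some (some none))))
    (.var (some none)))) (.lt (.add hh.lift.lift.lift hf.lift.lift.lift)
    (.add (.add (.var (some (some none))) (.var (some none))) (.var none))))))))))))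

lemma isDef_isBest {f : (α → ℝ) → ℝ} (hf : IsTerm d f) :
    IsDef d fun v => IsBest √(d : ℝ) (f v) := by
  unfold IsBest
  refine .and (.int_mul_sqrt hf) (.and (.lt hf (.add hf hf)) (.ex (.and (.int (.var none)) (.all
    (.imp (.int_mul_sqrt (.var none)) (.imp (.lt (.var none) (.add (.var none) (.var none))) (.imp
    (.lt (.var none) hf.lift.lift) (.all (.imp (.int (.var none)) ?_)))))))))
  have x := hf.lift.lift.lift
  have p : IsTerm d fun w : Option (Option (Option α)) → ℝ => w (some (some none)) := .var _
  have y : IsTerm d fun w : Option (Option (Option α)) → ℝ => w (some none) := .var _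
  have p' : IsTerm d fun w : Option (Option (Option α)) → ℝ => w none := .var _
  exact .or (.and (.lt (.add x p') (.add y p)) (.lt (.add p p') (.add y x)))
    (.and (.lt (.add x y) (.add p p')) (.lt (.add p y) (.add x p')))

lemma isDef_isNext {f g : (α → ℝ) → ℝ} (hf : IsTerm d f) (hg : IsTerm d g) :
    IsDef d fun v => IsNext √(d : ℝ) (f v) (g v) :=
  .and (isDef_isBest hf) (.and (isDef_isBest hg) (.and (.lt hf hg) (.all (.imp
    (isDef_isBest (.var none)) (.imp (.lt hf.lift (.var none)) (.not (.lt (.var none) hg.lift)))))))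

lemma isDef_isNextIter (r : ℕ) {α : Type} {f g : (α → ℝ) → ℝ} (hf : IsTerm d f)
    (hg : IsTerm d g) : IsDef d fun v => IsNextIter √(d : ℝ) r (f v) (g v) := by
  induction r generalizing α with
  | zero => exact .and (isDef_isBest hf) (.eq hf hg)
  | succ r ih => exact .ex (.and (ih hf.lift (.var none)) (isDef_isNext (.var none) hg.lift))

lemma isDef_inCode {f g : (α → ℝ) → ℝ} (hf : IsTerm d f) (hg : IsTerm d g) :
    IsDef d fun v => InCode √(d : ℝ) (f v) (g v) :=
  .ex (.and (isDef_isNext hf.lift (.var none)) (isDef_hits hf.lift (.var none) hg.lift))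

lemma isDef_isMultiple (M : ℕ) {f : (α → ℝ) → ℝ} (hf : IsTerm d f) :
    IsDef d fun v => IsMultiple √(d : ℝ) M (f v) :=
  .ex (.and (isDef_inCode hf.lift (.var none)) (.all (.imp (isDef_isBest (.var none)) (.imp
    (.not (.lt hf.lift.lift (.var none))) (.iff (isDef_inCode (.var none) (.var (some none))) (.or
    (.and (.ex (isDef_isNextIter _ (.var none) (.var (some none))))
    (.not (.ex (isDef_isNextIter _ (.var none) (.var (some none))))))
    (.ex (.and (isDef_inCode (.var none) (.var (some (some none))))
    (isDef_isNextIter _ (.var none) (.var (some none)))))))))))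

end Definability

lemma den_one {a : ℝ} (h1 : 1.5 < a) (h2 : a < 2) : den a 1 = 1 := by
  have h0 : ⌊a⌋ = 1 := by
    rw [Int.floor_eq_iff]
    constructor <;> push_cast <;> linarith
  have h : ⌊(a - 1)⁻¹⌋ = 1 := by
    rw [Int.floor_eq_iff]
    constructor
    · push_cast
      exact (one_le_inv₀ (by linarith)).2 (by linarith)
    · rw [inv_lt_comm₀ (by linarith) (by norm_num)]
      push_cast
      linarith
  simp [den, cfQ, cfA, cfZeta, h0, h]

end SqrtCF

theorem V_j_n_definable (d : ℚ) (h1 : 1.5 < Real.sqrt d) (h2 : Real.sqrt d < 2)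
    (hirr : Irrational (Real.sqrt d)) (n : ℕ) (hn : 1 < n) (j : ℕ) (hj : j < n) :
    letI := rStruc d
    Set.Definable₁ (∅ : Set ℝ) rLang
      {x : ℝ | ∃ l : ℕ, 0 < l ∧ l % n = j ∧ x = (cfQ (Real.sqrt d) (l + 1) : ℝ) * Real.sqrt d} := by
  have h1' := SqrtCF.den_one h1 h2
  have h0 : 0 < √(d : ℝ) := by linarith
  let := rStruc d
  obtain ⟨φ, hφ⟩ := SqrtCF.IsDef.exists_nat_lt (d := d) (α := Fin 1)
    (P := fun r v => ∃ y, SqrtCF.IsNextIter √(d : ℝ) r (v 0) y ∧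
      SqrtCF.IsMultiple √(d : ℝ) (2 * n) y) (fun r => (j + r) % n = 0)
    (fun r => .ex (.and (SqrtCF.isDef_isNextIter r (.var (some 0)) (.var none))
      (SqrtCF.isDef_isMultiple _ (.var none)))) (2 * n) 0
  rw [Set.Definable₁, Set.empty_definable_iff]
  refine ⟨φ, Set.ext fun v => ?_⟩
  exact (SqrtCF.exists_mod_eq_iff hirr h0 h1' hj).trans (hφ v).symm
end

section
/- Let a > 1 be a quadratic irrational with continued fraction expansion [a₀; a₁, a₂, …] of minimal period length m and convergent denominators qₖ, and set t = max(m, 2). Fix i ∈ {0,…,t−1}. Suppose n ∈ ℕ has Ostrowski representation n = Σ_k b_{k+1}·qₖ in which every digit b_{k+1} lies in {0,1} and b_{k+1} = 0 whenever k ≢ i (mod t). Then the shifted sum Σ_k b_{k+1}·q_{k+1} is itself the Ostrowski representation of the natural number l = Σ_k b_{k+1}·q_{k+1}; that is, the digit sequence (0, b₁, b₂, …) satisfies the Ostrowski digit conditions. -/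
open Real

/-- The Ostrowski digit conditions for a digit sequence `b`, where `b k` is the coefficient
of `qₖ` (i.e. `b k` is the digit `b_{k+1}` in the classical notation): `b₁ < a₁`,
`bₖ ≤ aₖ` for all `k`, and `b_{k-1} = 0` whenever `bₖ = aₖ`. -/
def OstrowskiDigits (a : ℝ) (b : ℕ → ℕ) : Prop :=
  (b 0 : ℤ) < cfA a 1 ∧ (∀ k : ℕ, (b k : ℤ) ≤ cfA a (k + 1)) ∧
    ∀ k : ℕ, (b (k + 1) : ℤ) = cfA a (k + 2) → b k = 0

/-- `b` is the (digit sequence of the) Ostrowski representation of `n` based on `a`: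
it has finite support, satisfies the digit conditions, and `n = Σ_k b_{k+1}·qₖ`. -/
def IsOstrowskiRep (a : ℝ) (b : ℕ → ℕ) (n : ℕ) : Prop :=
  (∃ K : ℕ, ∀ k : ℕ, K ≤ k → b k = 0) ∧ OstrowskiDigits a b ∧
    (n : ℝ) = ∑' k : ℕ, (b k : ℝ) * (cfQ a (k + 1) : ℝ)

/-- A real number is quadratic if it is a root of a nonzero polynomial over `ℚ`
of degree at most 2. -/
def IsQuadraticReal (a : ℝ) : Prop :=
  ∃ p : Polynomial ℚ, p ≠ 0 ∧ p.degree ≤ 2 ∧ Polynomial.aeval a p = 0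

theorem irrational_cfZeta_s10 {a : ℝ} (hirr : Irrational a) : ∀ k, Irrational (cfZeta a k)
  | 0 => hirr
  | k + 1 => ((irrational_cfZeta_s10 hirr k).sub_intCast _).inv

theorem one_le_cfA_succ {a : ℝ} (hirr : Irrational a) (k : ℕ) : 1 ≤ cfA a (k + 1) := by
  have hz := irrational_cfZeta_s10 hirr k
  have hpos : 0 < cfZeta a k - ⌊cfZeta a k⌋ :=
    lt_of_le_of_ne (sub_nonneg.2 (Int.floor_le _))
      fun h => hz.ne_int ⌊cfZeta a k⌋ (sub_eq_zero.1 h.symm)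
  have hle : cfZeta a k - ⌊cfZeta a k⌋ ≤ 1 := (Int.fract_lt_one (cfZeta a k)).le
  refine Int.le_floor.2 ?_
  simpa [cfZeta] using (one_le_inv₀ hpos).2 hle

theorem cfQ_nonneg {a : ℝ} (hirr : Irrational a) : ∀ k, 0 ≤ cfQ a k
  | 0 => le_rfl
  | 1 => zero_le_one
  | k + 2 => add_nonneg
      (mul_nonneg (zero_le_one.trans (one_le_cfA_succ hirr k)) (cfQ_nonneg hirr (k + 1)))
      (cfQ_nonneg hirr k)

theorem mod_ne_succ_mod {t : ℕ} (ht : 2 ≤ t) (k : ℕ) : k % t ≠ (k + 1) % t := by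
  intro h
  have hdvd : t ∣ k + 1 - k := (Nat.modEq_iff_dvd' k.le_succ).1 h
  have := Nat.le_of_dvd (by omega) hdvd
  omega

theorem shifted_ostrowski (a : ℝ) (ha : 1 < a) (hirr : Irrational a)
    (hquad : IsQuadraticReal a) (m : ℕ) (hm : IsMinPeriod a m)
    (i : ℕ) (hi : i < max m 2) (n : ℕ) (b : ℕ → ℕ)
    (hrep : IsOstrowskiRep a b n)
    (h01 : ∀ k : ℕ, b k ≤ 1)
    (hsupp : ∀ k : ℕ, k % (max m 2) ≠ i → b k = 0) :
    ∃ l : ℕ, (l : ℝ) = ∑' k : ℕ, (b k : ℝ) * (cfQ a (k + 2) : ℝ) ∧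
      IsOstrowskiRep a (fun k => if k = 0 then 0 else b (k - 1)) l := by
  obtain ⟨⟨K, hK⟩, -, -⟩ := hrep
  have hsum : HasSum (fun k => (b k : ℝ) * (cfQ a (k + 2) : ℝ))
      (∑ k ∈ Finset.range K, (b k : ℝ) * (cfQ a (k + 2) : ℝ)) := by
    refine hasSum_sum_of_ne_finset_zero fun k hk => ?_
    simp [hK k (by simpa using hk)]
  obtain ⟨l, hl⟩ := Int.eq_ofNat_of_zero_le
    (Finset.sum_nonneg fun k (_ : k ∈ Finset.range K) =>
      mul_nonneg (Int.natCast_nonneg (b k)) (cfQ_nonneg hirr (k + 2)))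
  have hlR : (l : ℝ) = ∑ k ∈ Finset.range K, (b k : ℝ) * (cfQ a (k + 2) : ℝ) := by
    exact_mod_cast hl.symm
  refine ⟨l, hlR.trans hsum.tsum_eq.symm, ⟨K + 1, fun k hk => ?_⟩, ⟨?_, fun k => ?_, ?_⟩, ?_⟩
  · simp [show k ≠ 0 by omega, hK (k - 1) (by omega)]
  · simpa using Int.lt_of_add_one_le (one_le_cfA_succ hirr 0)
  · have hA := one_le_cfA_succ hirr k
    have hb := h01 (k - 1)
    dsimp only
    split_ifs <;> omega
  · rintro (_ | k) hk
    · simp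
    · have hA := one_le_cfA_succ hirr (k + 2)
      have hbA : (b (k + 1) : ℤ) = cfA a (k + 2 + 1) := hk
      have hb : b (k + 1) ≠ 0 := by omega
      have hmod : (k + 1) % max m 2 = i := not_not.1 fun h => hb (hsupp _ h)
      simpa using hsupp k (hmod ▸ mod_ne_succ_mod (le_max_right m 2) k)
  · rw [hlR]
    refine ((hasSum_nat_add_iff' 1).1 ?_).tsum_eq.symm
    simpa using hsum
end
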